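/- arXiv:1303.4005 — 3 statements merged into one kernel-verified Lean document; each statement's English description precedes it below -/
import Mathlib

section
/- Let Y₁, …, Yₙ be independent random vectors in ℝ^d, and let λ₁, …, λₙ, λ be positive numbers with λₖ ≤ λ for all k. For each k set Mₖ(λₖ) = E min(‖Ỹₖ‖²/λₖ², 1), where Ỹₖ is a symmetrization of Yₖ. Assume Σₖ λₖ² Mₖ(λₖ) > 0. Then there exists an absolute constant c > 0 (independent of d and n) such that Q(L(Σₖ Yₖ), λ) ≤ c λ ( Σₖ λₖ² Mₖ(λₖ) )^{-1/2}. -/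
open MeasureTheory

/-- Concentration function `Q(μ, r) = sup_x μ(x + rB)` of a measure on `ℝ^d`. -/
noncomputable def concFn {d : ℕ} (μ : Measure (EuclideanSpace ℝ (Fin d))) (r : ℝ) : ℝ :=
  ⨆ x : EuclideanSpace ℝ (Fin d), (μ (Metric.closedBall x r)).toReal

/-- `M_k(τ) = E min(‖Ỹ‖²/τ², 1)`, where `Ỹ = Y - Y'` is the symmetrization of a
random vector with law `μ`. -/
noncomputable def MfnVec {d : ℕ} (μ : Measure (EuclideanSpace ℝ (Fin d))) (τ : ℝ) : ℝ :=
  ∫ p : EuclideanSpace ℝ (Fin d) × EuclideanSpace ℝ (Fin d),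
    min (‖p.1 - p.2‖ ^ 2 / τ ^ 2) 1 ∂(μ.prod μ)

open Real in
/-- The exponential of `-a (1 - cos u)` has integral `O(a ^ (-1/2))` over a period. -/
theorem integral_exp_neg_one_sub_cos_le {a : ℝ} (ha : 0 < a) :
    ∫ u in -π..π, exp (-(a * (1 - cos u))) ≤ √(π ^ 3 / (2 * a)) := by
  have hb : 0 < 2 * a / π ^ 2 := by positivity
  have key : ∀ u ∈ Set.Icc (-π) π,
      exp (-(a * (1 - cos u))) ≤ exp (-(2 * a / π ^ 2) * u ^ 2) := by
    intro u hu
    rw [exp_le_exp]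
    have h := mul_le_mul_of_nonneg_left (cos_le_one_sub_mul_cos_sq (abs_le.2 hu)) ha.le
    have e : a * (1 - 2 / π ^ 2 * u ^ 2) = a - 2 * a / π ^ 2 * u ^ 2 := by ring
    linarith
  calc ∫ u in -π..π, exp (-(a * (1 - cos u)))
      ≤ ∫ u in -π..π, exp (-(2 * a / π ^ 2) * u ^ 2) :=
        intervalIntegral.integral_mono_on (by linarith [pi_pos])
          (Continuous.intervalIntegrable (by fun_prop) _ _)
          (Continuous.intervalIntegrable (by fun_prop) _ _) key
    _ ≤ ∫ u, exp (-(2 * a / π ^ 2) * u ^ 2) := by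
        rw [intervalIntegral.integral_of_le (by linarith [pi_pos])]
        exact setIntegral_le_integral (integrable_exp_neg_mul_sq hb)
          (Filter.Eventually.of_forall fun _ => (exp_pos _).le)
    _ = √(π ^ 3 / (2 * a)) := by
        rw [integral_gaussian]
        congr 1
        field_simp

open Real in
theorem integral_exp_neg_one_sub_cos_mul_le {a s : ℝ} (ha : 0 < a) (hs : 0 < s) (t : ℝ) :
    ∫ x in t..t + 1, exp (-(a * (1 - cos (s * x)))) ≤
      s⁻¹ * ((s / (2 * π) + 1) * √(π ^ 3 / (2 * a))) := by
  set h : ℝ → ℝ := fun u => exp (-(a * (1 - cos u))) with hh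
  have hc : Continuous h := by fun_prop
  have hper : Function.Periodic h (2 * π) := fun u => by simp [hh]
  have hint : ∀ t₁ t₂, IntervalIntegrable h volume t₁ t₂ := fun _ _ => hc.intervalIntegrable _ _
  set n : ℕ := ⌈s / (2 * π)⌉₊
  have hn : s ≤ n * (2 * π) := by
    rw [← div_le_iff₀ (by positivity)]
    exact Nat.le_ceil _
  have hn' : (n : ℝ) ≤ s / (2 * π) + 1 := (Nat.ceil_lt_add_one (by positivity)).le
  have hH : ∫ x in s * t..s * t + 2 * π, h x ≤ √(π ^ 3 / (2 * a)) := by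
    rw [hper.intervalIntegral_add_eq (s * t) (-π)]
    convert integral_exp_neg_one_sub_cos_le ha using 2
    ring
  have e : ∫ x in t..t + 1, h (s * x) = s⁻¹ * ∫ u in s * t..s * (t + 1), h u := by
    rw [intervalIntegral.integral_comp_mul_left _ hs.ne', smul_eq_mul]
  change ∫ x in t..t + 1, h (s * x) ≤ _
  rw [e]
  refine mul_le_mul_of_nonneg_left ?_ (by positivity)
  calc ∫ u in s * t..s * (t + 1), h u
      ≤ ∫ u in s * t..s * t + (n : ℤ) • (2 * π), h u := by
        refine intervalIntegral.integral_mono_interval le_rfl (by nlinarith) ?_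
          (Filter.Eventually.of_forall fun _ => (exp_pos _).le) (hint _ _)
        simp only [zsmul_eq_mul, Int.cast_natCast]
        linarith
    _ = n * ∫ u in s * t..s * t + 2 * π, h u := by
        rw [hper.intervalIntegral_add_zsmul_eq _ _ hint]
        simp
    _ ≤ (s / (2 * π) + 1) * √(π ^ 3 / (2 * a)) :=
        mul_le_mul hn' hH (intervalIntegral.integral_nonneg (by linarith [pi_pos])
          fun _ _ => (exp_pos _).le) (by positivity)

open Real in
theorem inv_mul_sqrt_min_le {s D : ℝ} (hs : 0 < s) (hD : 0 < D) :
    s⁻¹ * ((s / (2 * π) + 1) * √(π ^ 3 / (2 * (D / (2 * min (s ^ 2) 1))))) ≤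
      2 * √(π ^ 3) / √D := by
  have hw : 0 < min (s ^ 2) 1 := by positivity
  have e : √(π ^ 3 / (2 * (D / (2 * min (s ^ 2) 1)))) = √(min (s ^ 2) 1) * (√(π ^ 3) / √D) := by
    rw [← sqrt_div (by positivity), ← sqrt_mul hw.le]
    congr 1
    field_simp
  rw [e, ← mul_assoc, ← mul_assoc, mul_div_assoc 2]
  refine mul_le_mul_of_nonneg_right ?_ (by positivity)
  have h1 : √(min (s ^ 2) 1) ≤ s := by
    rw [← sqrt_sq hs.le]
    exact sqrt_le_sqrt ((min_le_left _ _).trans (by rw [sqrt_sq hs.le]))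
  have h2 : √(min (s ^ 2) 1) ≤ 1 := by
    rw [sqrt_le_one]
    exact min_le_right _ _
  have h3 : s / (2 * π) * √(min (s ^ 2) 1) ≤ s * 1 :=
    mul_le_mul (div_le_self hs.le (by linarith [pi_gt_three])) h2 (by positivity) hs.le
  rw [mul_assoc, inv_mul_le_iff₀ hs]
  linarith

open Real ProbabilityTheory in
/-- Uniformly in the scale `s`, the Gaussian average of `exp (-a (1 - cos (s x)))` with
`a = D / (2 min (s², 1))` is `O(D ^ (-1/2))`. -/
theorem exists_integral_gaussianReal_exp_neg_one_sub_cos_le :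
    ∃ C : ℝ, 0 < C ∧ ∀ s D : ℝ, 0 < s → 0 < D →
      ∫ x, exp (-(D / (2 * min (s ^ 2) 1) * (1 - cos (s * x)))) ∂gaussianReal 0 1 ≤ C / √D := by
  have hsum : Summable fun j : ℤ => exp (3 / 2) * exp (-|(j : ℝ)|) := by
    refine Summable.mul_left _ (Summable.of_nat_of_neg ?_ ?_) <;>
    · simpa using summable_exp_neg_nat
  refine ⟨(∑' j : ℤ, exp (3 / 2) * exp (-|(j : ℝ)|)) * (2 * √(π ^ 3)), ?_, ?_⟩
  · have : 0 < ∑' j : ℤ, exp (3 / 2) * exp (-|(j : ℝ)|) :=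
      hsum.tsum_pos (fun _ => by positivity) 0 (by positivity)
    positivity
  intro s D hs hD
  have hw : 0 < min (s ^ 2) 1 := by positivity
  set a : ℝ := D / (2 * min (s ^ 2) 1) with ha_def
  have ha : 0 < a := by positivity
  set h : ℝ → ℝ := fun x => exp (-(a * (1 - cos (s * x)))) with hh
  have hc : Continuous h := by fun_prop
  have hle : ∀ x, h x ≤ 1 := fun x => by
    simp only [hh, exp_le_one_iff, Left.neg_nonpos_iff]
    have := cos_le_one (s * x)
    exact mul_nonneg ha.le (by linarith)
  rw [integral_gaussianReal_eq_integral_smul one_ne_zero]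
  simp only [smul_eq_mul]
  have hI : Integrable fun x => gaussianPDFReal 0 1 x * h x :=
    (integrable_gaussianPDFReal 0 1).mul_bdd (c := 1) hc.aestronglyMeasurable
      (Filter.Eventually.of_forall fun x => by
        rw [norm_of_nonneg (exp_pos _).le]; exact hle x)
  have hS := hasSum_integral_iUnion (μ := volume) (s := fun j : ℤ => Set.Ioc (j : ℝ) (j + 1))
    (f := fun x => gaussianPDFReal 0 1 x * h x) (fun _ => measurableSet_Ioc)
    (Set.pairwise_disjoint_Ioc_intCast ℝ) hI.integrableOn
  rw [iUnion_Ioc_intCast, setIntegral_univ] at hS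
  have hpdf : ∀ (j : ℤ), ∀ x ∈ Set.Ioc (j : ℝ) (j + 1),
      gaussianPDFReal 0 1 x ≤ exp (3 / 2) * exp (-|(j : ℝ)|) := by
    intro j x hx
    rw [gaussianPDFReal, ← exp_add]
    have h1 : (√(2 * π * (1 : NNReal)))⁻¹ ≤ 1 := by
      apply inv_le_one_of_one_le₀
      rw [one_le_sqrt]
      norm_num
      linarith [pi_gt_three]
    refine (mul_le_of_le_one_left (exp_pos _).le h1).trans ?_
    rw [exp_le_exp]
    have h2 : |(j : ℝ)| ≤ |x| + 1 := by
      rw [abs_le]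
      constructor <;> cases abs_cases x <;> linarith [hx.1, hx.2]
    have h3 : |x| ≤ 1 / 2 + x ^ 2 / 2 := by nlinarith [sq_nonneg (|x| - 1), sq_abs x]
    norm_num
    linarith
  have hj : ∀ j : ℤ, ∫ x in Set.Ioc (j : ℝ) (j + 1), gaussianPDFReal 0 1 x * h x ≤
      exp (3 / 2) * exp (-|(j : ℝ)|) * (2 * √(π ^ 3) / √D) := by
    intro j
    calc ∫ x in Set.Ioc (j : ℝ) (j + 1), gaussianPDFReal 0 1 x * h x
        ≤ ∫ x in Set.Ioc (j : ℝ) (j + 1), exp (3 / 2) * exp (-|(j : ℝ)|) * h x := by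
          refine setIntegral_mono_on hI.integrableOn ?_ measurableSet_Ioc fun x hx =>
            mul_le_mul_of_nonneg_right (hpdf j x hx) (exp_pos _).le
          exact (Continuous.integrableOn_Icc (by fun_prop)).mono_set Set.Ioc_subset_Icc_self
      _ = exp (3 / 2) * exp (-|(j : ℝ)|) * ∫ x in (j : ℝ)..j + 1, h x := by
          rw [integral_const_mul, intervalIntegral.integral_of_le (by linarith)]
      _ ≤ _ := by
          refine mul_le_mul_of_nonneg_left ?_ (by positivity)
          exact (integral_exp_neg_one_sub_cos_mul_le ha hs _).trans (inv_mul_sqrt_min_le hs hD)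
  have := hasSum_le hj hS (hsum.hasSum.mul_right _)
  rwa [mul_div_assoc]

open ProbabilityTheory in
/-- The marginal of the standard Gaussian measure in direction `v` is a centred Gaussian of
standard deviation `‖v‖`. -/
theorem map_inner_stdGaussian {E : Type*} [NormedAddCommGroup E] [InnerProductSpace ℝ E]
    [FiniteDimensional ℝ E] [MeasurableSpace E] [BorelSpace E] (v : E) :
    (stdGaussian E).map (fun g => inner ℝ v g) = (gaussianReal 0 1).map (fun x => ‖v‖ * x) := by
  rw [gaussianReal_map_const_mul]
  change (stdGaussian E).map (innerSL ℝ v) = _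
  have : IsProbabilityMeasure ((stdGaussian E).map (innerSL ℝ v)) :=
    Measure.isProbabilityMeasure_map (by fun_prop)
  refine Measure.ext_of_charFun (funext fun u => ?_)
  rw [charFun_map_eq_charFunDual_smul, charFunDual_stdGaussian, charFun_gaussianReal, norm_smul,
    innerSL_apply_norm]
  congr 1
  have hu : ((‖u‖ : ℝ) : ℂ) ^ 2 = (u : ℂ) ^ 2 := by
    rw [← Complex.ofReal_pow, Real.norm_eq_abs, sq_abs, Complex.ofReal_pow]
  simp [mul_pow, -Real.norm_eq_abs, hu]
  ring

open ProbabilityTheory in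
theorem integral_stdGaussian_inner {E : Type*} [NormedAddCommGroup E] [InnerProductSpace ℝ E]
    [FiniteDimensional ℝ E] [MeasurableSpace E] [BorelSpace E] (v : E) {f : ℝ → ℝ}
    (hf : Continuous f) :
    ∫ g, f (inner ℝ v g) ∂stdGaussian E = ∫ x, f (‖v‖ * x) ∂gaussianReal 0 1 := by
  rw [← integral_map (φ := fun g => inner ℝ v g) (by fun_prop) hf.aestronglyMeasurable,
    map_inner_stdGaussian, integral_map (by fun_prop) hf.aestronglyMeasurable]

open ProbabilityTheory Complex in
/-- A dimension-free Esseen inequality: the mass of a ball is controlled by the Gaussian average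
of the modulus of the characteristic function. -/
theorem measureReal_closedBall_le_integral_norm_charFun {E : Type*} [NormedAddCommGroup E]
    [InnerProductSpace ℝ E] [FiniteDimensional ℝ E] [MeasurableSpace E] [BorelSpace E]
    (μ : Measure E) [IsProbabilityMeasure μ] {r : ℝ} (hr : 0 < r) (x : E) :
    μ.real (Metric.closedBall x r) ≤
      Real.exp (1 / 2) * ∫ g, ‖charFun μ (r⁻¹ • g)‖ ∂stdGaussian E := by
  set φ : E → ℝ := fun v => Real.exp (-‖r⁻¹ • (v - x)‖ ^ 2 / 2) with hφ
  have hφc : Continuous φ := by fun_prop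
  have hφi : Integrable φ μ := by
    refine .of_bound hφc.aestronglyMeasurable 1 (.of_forall fun v => ?_)
    rw [Real.norm_of_nonneg (Real.exp_pos _).le, Real.exp_le_one_iff]
    have := sq_nonneg ‖r⁻¹ • (v - x)‖
    linarith
  have h1 : μ.real (Metric.closedBall x r) ≤ Real.exp (1 / 2) * ∫ v, φ v ∂μ := by
    rw [← integral_const_mul, ← integral_indicator_one Metric.isClosed_closedBall.measurableSet]
    refine integral_mono ?_ (hφi.const_mul _) fun v => ?_
    · exact (integrable_const 1).indicator Metric.isClosed_closedBall.measurableSet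
    · by_cases hv : v ∈ Metric.closedBall x r
      · rw [Set.indicator_of_mem hv]
        simp only [hφ, ← Real.exp_add, Pi.one_apply, Real.one_le_exp_iff]
        rw [mem_closedBall_iff_norm] at hv
        have : ‖r⁻¹ • (v - x)‖ ≤ 1 := by
          rw [norm_smul, Real.norm_of_nonneg (by positivity), inv_mul_le_iff₀ hr]
          linarith
        nlinarith [norm_nonneg (r⁻¹ • (v - x))]
      · rw [Set.indicator_of_notMem hv]
        positivity
  refine h1.trans (mul_le_mul_of_nonneg_left ?_ (Real.exp_pos _).le)
  have h2 : ((∫ v, φ v ∂μ : ℝ) : ℂ) =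
      ∫ g, exp (-(inner ℝ x (r⁻¹ • g) : ℝ) * I) * charFun μ (r⁻¹ • g) ∂stdGaussian E := by
    calc ((∫ v, φ v ∂μ : ℝ) : ℂ) = ∫ v, charFun (stdGaussian E) (r⁻¹ • (v - x)) ∂μ := by
          rw [← integral_complex_ofReal]
          refine integral_congr_ae (.of_forall fun v => ?_)
          simp [hφ, charFun_stdGaussian]
      _ = ∫ v, ∫ g, exp ((inner ℝ g (r⁻¹ • (v - x)) : ℝ) * I) ∂stdGaussian E ∂μ := rfl
      _ = ∫ g, ∫ v, exp ((inner ℝ g (r⁻¹ • (v - x)) : ℝ) * I) ∂μ ∂stdGaussian E := by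
          refine integral_integral_swap ?_
          refine .of_bound (Continuous.aestronglyMeasurable ?_) 1 (.of_forall fun p => ?_)
          · unfold Function.uncurry
            fun_prop
          · simp only [Function.uncurry, norm_exp_ofReal_mul_I, le_refl]
      _ = _ := by
          refine integral_congr_ae (.of_forall fun g => ?_)
          simp only [charFun_apply, ← integral_const_mul, ← Complex.exp_add]
          refine integral_congr_ae (.of_forall fun v => ?_)
          simp only [inner_smul_right, inner_sub_right, real_inner_comm g]
          congr 1
          push_cast
          ring
  calc ∫ v, φ v ∂μ ≤ ‖((∫ v, φ v ∂μ : ℝ) : ℂ)‖ := by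
        rw [norm_real]
        exact le_abs_self _
    _ ≤ ∫ g, ‖exp (-(inner ℝ x (r⁻¹ • g) : ℝ) * I) * charFun μ (r⁻¹ • g)‖ ∂stdGaussian E := by
        rw [h2]
        exact norm_integral_le_integral_norm _
    _ = _ := by
        refine integral_congr_ae (.of_forall fun g => ?_)
        simp only [norm_mul, ← ofReal_neg, norm_exp_ofReal_mul_I, one_mul]

open Complex in
theorem norm_charFun_sq_eq_integral_cos {E : Type*} [NormedAddCommGroup E]
    [InnerProductSpace ℝ E] [MeasurableSpace E] [BorelSpace E] [SecondCountableTopology E]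
    (μ : Measure E) [IsProbabilityMeasure μ] (t : E) :
    ‖charFun μ t‖ ^ 2 = ∫ p : E × E, Real.cos (inner ℝ (p.1 - p.2) t) ∂μ.prod μ := by
  have h : ((‖charFun μ t‖ ^ 2 : ℝ) : ℂ) =
      ∫ p : E × E, exp ((inner ℝ (p.1 - p.2) t : ℝ) * I) ∂μ.prod μ := by
    calc ((‖charFun μ t‖ ^ 2 : ℝ) : ℂ) = charFun μ t * charFun μ (-t) := by
          rw [charFun_neg, mul_conj, normSq_eq_norm_sq]
      _ = _ := by
          rw [charFun_apply, charFun_apply, ← integral_prod_mul]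
          refine integral_congr_ae (.of_forall fun p => ?_)
          simp only [← Complex.exp_add, inner_neg_right, inner_sub_left]
          congr 1
          push_cast
          ring
  have hi : Integrable (fun p : E × E => exp ((inner ℝ (p.1 - p.2) t : ℝ) * I)) (μ.prod μ) :=
    .of_bound (Continuous.aestronglyMeasurable (by fun_prop)) 1
      (.of_forall fun p => (norm_exp_ofReal_mul_I _).le)
  have h' := congrArg re h
  rw [ofReal_re, ← RCLike.re_eq_complex_re, ← integral_re hi] at h'
  rw [h']
  simp only [RCLike.re_eq_complex_re, exp_ofReal_mul_I_re]

theorem norm_charFun_le_exp {E : Type*} [NormedAddCommGroup E]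
    [InnerProductSpace ℝ E] [MeasurableSpace E] [BorelSpace E] [SecondCountableTopology E]
    (μ : Measure E) [IsProbabilityMeasure μ] (t : E) :
    ‖charFun μ t‖ ≤
      Real.exp (-(1 / 2 * ∫ p : E × E, (1 - Real.cos (inner ℝ (p.1 - p.2) t)) ∂μ.prod μ)) := by
  have hi : Integrable (fun p : E × E => Real.cos (inner ℝ (p.1 - p.2) t)) (μ.prod μ) :=
    .of_bound (Continuous.aestronglyMeasurable (by fun_prop)) 1
      (.of_forall fun p => Real.abs_cos_le_one _)
  rw [integral_sub (integrable_const _) hi, ← norm_charFun_sq_eq_integral_cos]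
  refine le_of_sq_le_sq ?_ (Real.exp_pos _).le
  rw [← Real.exp_nat_mul]
  simp only [integral_const, probReal_univ, smul_eq_mul]
  have h := Real.add_one_le_exp (‖charFun μ t‖ ^ 2 - 1)
  rw [sub_add_cancel] at h
  refine h.trans_eq (congrArg Real.exp ?_)
  push_cast
  ring

/-- Jensen's inequality for `exp (-z)` and the normalized sum of the measures `w • ν k`. -/
theorem exp_neg_weighted_average_le {ι Ω : Type*} [Fintype ι] [MeasurableSpace Ω]
    (ν : ι → Measure Ω) {w z : Ω → ℝ} (hw0 : ∀ p, 0 ≤ w p) (hw : ∀ k, Integrable w (ν k))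
    (hwz : ∀ k, Integrable (fun p => w p * z p) (ν k))
    (hwe : ∀ k, Integrable (fun p => w p * Real.exp (-z p)) (ν k))
    (hD : 0 < ∑ k, ∫ p, w p ∂ν k) :
    Real.exp (-((∑ k, ∫ p, w p ∂ν k)⁻¹ * ∑ k, ∫ p, w p * z p ∂ν k)) ≤
      (∑ k, ∫ p, w p ∂ν k)⁻¹ * ∑ k, ∫ p, w p * Real.exp (-z p) ∂ν k := by
  set D := ∑ k, ∫ p, w p ∂ν k
  set A := D⁻¹ * ∑ k, ∫ p, w p * z p ∂ν k with hA
  have hpt : ∀ p, Real.exp (-A) * ((1 + A) * w p - w p * z p) ≤ w p * Real.exp (-z p) := by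
    intro p
    have h := mul_le_mul_of_nonneg_left (Real.add_one_le_exp (A - z p)) (Real.exp_pos (-A)).le
    rw [← Real.exp_add, show -A + (A - z p) = -z p by ring] at h
    nlinarith [mul_le_mul_of_nonneg_left h (hw0 p)]
  have hk : ∀ k, Real.exp (-A) * ((1 + A) * ∫ p, w p ∂ν k - ∫ p, w p * z p ∂ν k) ≤
      ∫ p, w p * Real.exp (-z p) ∂ν k := by
    intro k
    rw [← integral_const_mul, ← integral_sub ((hw k).const_mul _) (hwz k), ← integral_const_mul]
    exact integral_mono ((((hw k).const_mul _).sub (hwz k)).const_mul _) (hwe k) hpt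
  have hsum := Finset.sum_le_sum fun k (_ : k ∈ Finset.univ) => hk k
  rw [← Finset.mul_sum, Finset.sum_sub_distrib, ← Finset.mul_sum] at hsum
  have hAD : ∑ k, ∫ p, w p * z p ∂ν k = A * D := by
    rw [hA]
    field_simp
  rw [hAD] at hsum
  change Real.exp (-A) * ((1 + A) * D - A * D) ≤ _ at hsum
  rw [le_inv_mul_iff₀ hD]
  linarith

open ProbabilityTheory in
/-- A Kolmogorov–Rogozin inequality, with a constant independent of the dimension, for
truncations all at the level of the radius `r`. -/
theorem exists_measureReal_closedBall_sum_le :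
    ∃ C : ℝ, 0 < C ∧ ∀ (d n : ℕ) (F : Fin n → Measure (EuclideanSpace ℝ (Fin d))),
      (∀ k, IsProbabilityMeasure (F k)) → ∀ r : ℝ, 0 < r → 0 < ∑ k, MfnVec (F k) r →
      ∀ x, ((Measure.pi F).map (fun ω => ∑ k, ω k)).real (Metric.closedBall x r) ≤
        C / √(∑ k, MfnVec (F k) r) := by
  obtain ⟨C, hC, hgauss⟩ := exists_integral_gaussianReal_exp_neg_one_sub_cos_le
  refine ⟨Real.exp (1 / 2) * C, by positivity, ?_⟩
  intro d n F hF r hr hD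
  set E := EuclideanSpace ℝ (Fin d)
  set D := ∑ k, MfnVec (F k) r with hD_def
  set μ := (Measure.pi F).map (fun ω => ∑ k, ω k)
  have : IsProbabilityMeasure μ :=
    Measure.isProbabilityMeasure_map (Measurable.aemeasurable (by fun_prop))
  set w : E × E → ℝ := fun p => min (‖p.1 - p.2‖ ^ 2 / r ^ 2) 1 with hw_def
  set z : E → E × E → ℝ := fun g p =>
    D / (2 * w p) * (1 - Real.cos (inner ℝ (p.1 - p.2) (r⁻¹ • g))) with hz_def
  have hw_cont : Continuous w := by fun_prop
  have hw0 : ∀ p, 0 ≤ w p := fun p => by positivity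
  have hw1 : ∀ p, ‖w p‖ ≤ 1 := fun p => by
    rw [Real.norm_of_nonneg (hw0 p)]
    exact min_le_right _ _
  have hw : ∀ k, Integrable w ((F k).prod (F k)) := fun k =>
    .of_bound hw_cont.aestronglyMeasurable 1 (.of_forall hw1)
  have hw_eq_zero : ∀ p, w p = 0 → p.1 - p.2 = 0 := by
    intro p hp
    by_contra h
    have : 0 < w p := by
      have := norm_pos_iff.2 h
      positivity
    exact this.ne' hp
  have hwz : ∀ g p, w p * z g p = D * (1 / 2) * (1 - Real.cos (inner ℝ (p.1 - p.2) (r⁻¹ • g))) := by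
    intro g p
    by_cases hp : w p = 0
    · simp [hp, hw_eq_zero p hp]
    · simp only [hz_def]
      field_simp
  have hz0 : ∀ g p, 0 ≤ z g p := fun g p =>
    mul_nonneg (div_nonneg hD.le (mul_nonneg zero_le_two (hw0 p)))
      (sub_nonneg.2 (Real.cos_le_one _))
  have hz_meas : Measurable (fun q : E × (E × E) => z q.1 q.2) := by
    have h1 : Measurable fun q : E × (E × E) => w q.2 := hw_cont.measurable.comp measurable_snd
    have h2 : Continuous fun q : E × (E × E) =>
        1 - Real.cos (inner ℝ (q.2.1 - q.2.2) (r⁻¹ • q.1)) := by fun_prop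
    exact (measurable_const.div (h1.const_mul 2)).mul h2.measurable
  have hwe_meas : Measurable (fun q : E × (E × E) => w q.2 * Real.exp (-z q.1 q.2)) :=
    (hw_cont.measurable.comp measurable_snd).mul hz_meas.neg.exp
  have hwe_bound : ∀ g p, ‖w p * Real.exp (-z g p)‖ ≤ 1 := by
    intro g p
    rw [norm_mul, Real.norm_of_nonneg (Real.exp_pos _).le]
    exact mul_le_one₀ (hw1 p) (Real.exp_pos _).le (Real.exp_le_one_iff.2 (by linarith [hz0 g p]))
  have hwe : ∀ k, Integrable (fun q : E × (E × E) => w q.2 * Real.exp (-z q.1 q.2))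
      ((stdGaussian E).prod ((F k).prod (F k))) := fun k =>
    .of_bound hwe_meas.aestronglyMeasurable 1 (.of_forall fun q => hwe_bound q.1 q.2)
  have hchar : ∀ g, ‖charFun μ (r⁻¹ • g)‖ ≤
      D⁻¹ * ∑ k, ∫ p, w p * Real.exp (-z g p) ∂(F k).prod (F k) := by
    intro g
    have hJ := exp_neg_weighted_average_le (fun k => (F k).prod (F k)) (z := z g) hw0 hw ?_ ?_ hD
    · refine le_trans ?_ hJ
      rw [charFun_map_sum_pi_eq_prod, Finset.prod_apply, norm_prod]
      refine (Finset.prod_le_prod (fun _ _ => norm_nonneg _)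
        fun k _ => norm_charFun_le_exp (F k) (r⁻¹ • g)).trans_eq ?_
      rw [← Real.exp_sum, Finset.sum_neg_distrib]
      simp only [hwz, integral_const_mul, ← Finset.mul_sum]
      change _ = Real.exp (-(D⁻¹ * _))
      congr 2
      field_simp
    · intro k
      simp only [hwz]
      refine Integrable.const_mul (.of_bound (Continuous.aestronglyMeasurable (by fun_prop)) 2
        (.of_forall fun p => ?_)) _
      rw [Real.norm_eq_abs, abs_le]
      constructor <;>
        linarith [Real.cos_le_one (inner ℝ (p.1 - p.2) (r⁻¹ • g)),
          Real.neg_one_le_cos (inner ℝ (p.1 - p.2) (r⁻¹ • g))]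
    · exact fun k => .of_bound (hwe_meas.comp measurable_prodMk_left).aestronglyMeasurable 1
        (.of_forall (hwe_bound g))
  have hinner : ∀ p, w p * ∫ g, Real.exp (-z g p) ∂stdGaussian E ≤ w p * (C / √D) := by
    intro p
    by_cases hp : w p = 0
    · simp [hp]
    refine mul_le_mul_of_nonneg_left ?_ (hw0 p)
    have hp' : p.1 - p.2 ≠ 0 := fun h => hp (by simp [hw_def, h])
    have hs : 0 < r⁻¹ * ‖p.1 - p.2‖ := mul_pos (inv_pos.2 hr) (norm_pos_iff.2 hp')
    refine le_trans (le_of_eq ?_) (hgauss _ D hs hD)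
    have hws : w p = min ((r⁻¹ * ‖p.1 - p.2‖) ^ 2) 1 := by
      simp only [hw_def]
      congr 1
      field_simp
    rw [← hws]
    have := integral_stdGaussian_inner (p.1 - p.2)
      (f := fun y => Real.exp (-(D / (2 * w p) * (1 - Real.cos (r⁻¹ * y))))) (by fun_prop)
    simpa only [hz_def, inner_smul_right, mul_assoc] using this
  have hfub : ∀ k, ∫ g, ∫ p, w p * Real.exp (-z g p) ∂(F k).prod (F k) ∂stdGaussian E ≤
      MfnVec (F k) r * (C / √D) := by
    intro k
    rw [integral_integral_swap (hwe k)]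
    change _ ≤ (∫ p, w p ∂(F k).prod (F k)) * _
    rw [← integral_mul_const]
    refine integral_mono (hwe k).integral_prod_right ((hw k).mul_const _) fun p => ?_
    simp only [integral_const_mul]
    exact hinner p
  have hmain : ∫ g, ‖charFun μ (r⁻¹ • g)‖ ∂stdGaussian E ≤ C / √D := by
    have hint : ∀ k, Integrable (fun g => ∫ p, w p * Real.exp (-z g p) ∂(F k).prod (F k))
        (stdGaussian E) := fun k => (hwe k).integral_prod_left
    calc ∫ g, ‖charFun μ (r⁻¹ • g)‖ ∂stdGaussian E
        ≤ ∫ g, D⁻¹ * ∑ k, ∫ p, w p * Real.exp (-z g p) ∂(F k).prod (F k) ∂stdGaussian E := by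
          refine integral_mono ?_ ((integrable_finsetSum _ fun k _ => hint k).const_mul _) hchar
          exact .of_bound (Measurable.aestronglyMeasurable (by fun_prop)) 1
            (.of_forall fun g => by simpa using norm_charFun_le_one _)
      _ = D⁻¹ * ∑ k, ∫ g, ∫ p, w p * Real.exp (-z g p) ∂(F k).prod (F k) ∂stdGaussian E := by
          rw [integral_const_mul, integral_finsetSum _ fun k _ => hint k]
      _ ≤ D⁻¹ * ∑ k, MfnVec (F k) r * (C / √D) :=
          mul_le_mul_of_nonneg_left (Finset.sum_le_sum fun k _ => hfub k) (by positivity)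
      _ = C / √D := by
          rw [← Finset.sum_mul, ← hD_def, inv_mul_cancel_left₀ hD.ne']
  intro x
  refine (measureReal_closedBall_le_integral_norm_charFun μ hr x).trans ?_
  rw [mul_div_assoc]
  exact mul_le_mul_of_nonneg_left hmain (Real.exp_pos _).le

theorem sq_mul_MfnVec_mono {d : ℕ} (μ : Measure (EuclideanSpace ℝ (Fin d)))
    [IsProbabilityMeasure μ] {s r : ℝ} (hs : 0 < s) (hsr : s ≤ r) :
    s ^ 2 * MfnVec μ s ≤ r ^ 2 * MfnVec μ r := by
  have hr : 0 < r := hs.trans_le hsr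
  have hmul : ∀ {t : ℝ}, 0 < t → ∀ a : ℝ, t ^ 2 * min (a / t ^ 2) 1 = min a (t ^ 2) := by
    intro t ht a
    rw [mul_min_of_nonneg _ _ (sq_nonneg t), mul_one, mul_div_cancel₀ _ (by positivity)]
  have hint : ∀ t : ℝ, Integrable (fun p : EuclideanSpace ℝ (Fin d) × EuclideanSpace ℝ (Fin d) =>
      t ^ 2 * min (‖p.1 - p.2‖ ^ 2 / t ^ 2) 1) (μ.prod μ) := fun t =>
    Integrable.const_mul (.of_bound (Continuous.aestronglyMeasurable (by fun_prop)) 1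
      (.of_forall fun p => by
        rw [Real.norm_of_nonneg (by positivity)]
        exact min_le_right _ _)) _
  simp only [MfnVec, ← integral_const_mul]
  refine integral_mono (hint s) (hint r) fun p => ?_
  simp only [hmul hs, hmul hr]
  gcongr

theorem stmt_8 :
    ∃ c : ℝ, 0 < c ∧
      ∀ (d n : ℕ) (F : Fin n → Measure (EuclideanSpace ℝ (Fin d))),
      (∀ k, IsProbabilityMeasure (F k)) →
      ∀ (lamv : Fin n → ℝ) (lam : ℝ),
      (∀ k, 0 < lamv k) → 0 < lam → (∀ k, lamv k ≤ lam) →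
      0 < ∑ k, lamv k ^ 2 * MfnVec (F k) (lamv k) →
      concFn ((Measure.pi F).map (fun ω => ∑ k, ω k)) lam ≤
        c * lam / Real.sqrt (∑ k, lamv k ^ 2 * MfnVec (F k) (lamv k)) := by
  obtain ⟨C, hC, hconc⟩ := exists_measureReal_closedBall_sum_le
  refine ⟨C, hC, ?_⟩
  intro d n F hF lamv lam hlamv hlam hle hpos
  have hT : ∑ k, lamv k ^ 2 * MfnVec (F k) (lamv k) ≤ lam ^ 2 * ∑ k, MfnVec (F k) lam := by
    rw [Finset.mul_sum]
    exact Finset.sum_le_sum fun k _ => sq_mul_MfnVec_mono (F k) (hlamv k) (hle k)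
  set T := ∑ k, lamv k ^ 2 * MfnVec (F k) (lamv k)
  have hD : 0 < ∑ k, MfnVec (F k) lam := pos_of_mul_pos_right (hpos.trans_le hT) (by positivity)
  refine ciSup_le fun x => (hconc d n F hF lam hlam hD x).trans ?_
  rw [div_le_div_iff₀ (Real.sqrt_pos.2 hD) (Real.sqrt_pos.2 hpos), mul_assoc]
  refine mul_le_mul_of_nonneg_left ?_ hC.le
  refine (Real.sqrt_le_sqrt hT).trans_eq ?_
  rw [Real.sqrt_mul (by positivity), Real.sqrt_sq hlam.le]
end

section
/- Let X, X₁, …, Xₙ be i.i.d. real-valued random variables with Q(L(X), 1) ≤ 1 − p for some p > 0. Let a = (a₁, …, aₙ) with aₖ ∈ ℝ^d satisfy Σₖ⟨t,aₖ⟩² ≥ ‖t‖² for all t ∈ ℝ^d. Let α, D > 0 and γ ∈ (0,1), and suppose (Σₖ(⟨t,aₖ⟩ − mₖ)²)^{1/2} ≥ min{γ‖t·a‖, α} for all integers m₁, …, mₙ and all t ∈ ℝ^d with ‖t‖ ≤ D. Then there exists an absolute constant c₁ > 0 such that Q(F_a, d/D) ≤ c₁^d ( (√d/(γ D √p))^d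 + exp(−2 p α²) ). -/
open MeasureTheory
open scoped RealInnerProductSpace

/-- Law of `S_a = ∑ k, X_k • a_k`, where `X_1, …, X_n` are i.i.d. with law `ν`. -/
noncomputable def sumLaw {d n : ℕ} (ν : Measure ℝ) (a : Fin n → EuclideanSpace ℝ (Fin d)) :
    Measure (EuclideanSpace ℝ (Fin d)) :=
  (Measure.pi fun _ : Fin n => ν).map (fun ω => ∑ k, ω k • a k)

/-- `M(τ) = E min(X̃²/τ², 1)`, where `X̃ = X₁ - X₂` with `X₁, X₂` i.i.d. of law `ν`. -/
noncomputable def Mfn (ν : Measure ℝ) (τ : ℝ) : ℝ :=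
  ∫ p : ℝ × ℝ, min ((p.1 - p.2) ^ 2 / τ ^ 2) 1 ∂(ν.prod ν)

/-- The matrix `𝑁 = ∑ k, aₖ aₖᵀ`. -/
noncomputable def covMat {d n : ℕ} (a : Fin n → EuclideanSpace ℝ (Fin d)) :
    Matrix (Fin d) (Fin d) ℝ :=
  Matrix.of fun i j => ∑ k, a k i * a k j

/-- One-dimensional concentration function `Q(ν, r) = sup_x ν [x - r, x + r]`. -/
noncomputable def concFn1 (ν : Measure ℝ) (r : ℝ) : ℝ :=
  ⨆ x : ℝ, (ν (Metric.closedBall x r)).toReal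

open scoped BigOperators
open ProbabilityTheory

section CharacteristicFunction

lemma eight_mul_sq_norm_le_one_sub_cos (θ : ℝ) :
    8 * ‖((θ / (2 * Real.pi) : ℝ) : UnitAddCircle)‖ ^ 2 ≤ 1 - Real.cos θ := by
  have hpi := Real.pi_pos
  set x : ℝ := θ / (2 * Real.pi) with hx
  have hθ : θ = 2 * Real.pi * x := by rw [hx]; field_simp
  set y : ℝ := x - round x with hy
  have habs : |y| ≤ 1 / 2 := abs_sub_round x
  have hcos : Real.cos θ = Real.cos (2 * Real.pi * y) := by
    rw [hθ, hy, mul_sub, mul_comm (2 * Real.pi) (round x : ℝ), Real.cos_sub_int_mul_two_pi]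
  have hbound : |2 * Real.pi * y| ≤ Real.pi := by
    rw [abs_mul, abs_of_pos (by positivity)]
    nlinarith
  have h := Real.cos_le_one_sub_mul_cos_sq hbound
  have h2 : 2 / Real.pi ^ 2 * (2 * Real.pi * y) ^ 2 = 8 * y ^ 2 := by field_simp; ring
  rw [UnitAddCircle.norm_eq, sq_abs, hcos]
  linarith

lemma continuous_norm_coe_unitAddCircle :
    Continuous fun x : ℝ => ‖(x : UnitAddCircle)‖ :=
  continuous_norm.comp (AddCircle.continuous_mk' 1)

lemma norm_coe_unitAddCircle_le_half (x : ℝ) : ‖(x : UnitAddCircle)‖ ≤ 1 / 2 := by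
  rw [UnitAddCircle.norm_eq]
  exact abs_sub_round x

/-- The law of `X₁ - X₂` for independent `X₁`, `X₂` with law `ν`. -/
noncomputable def symmetrization (ν : Measure ℝ) : Measure ℝ := ν ∗ ν.map Neg.neg

instance (ν : Measure ℝ) [IsProbabilityMeasure ν] : IsProbabilityMeasure (symmetrization ν) := by
  have : IsProbabilityMeasure (ν.map Neg.neg) :=
    Measure.isProbabilityMeasure_map measurable_neg.aemeasurable
  unfold symmetrization
  infer_instance

lemma sq_norm_charFun_eq_integral_cos (ν : Measure ℝ) [IsProbabilityMeasure ν] (s : ℝ) :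
    ‖charFun ν s‖ ^ 2 = ∫ x, Real.cos (x * s) ∂(symmetrization ν) := by
  have : IsProbabilityMeasure (ν.map Neg.neg) :=
    Measure.isProbabilityMeasure_map measurable_neg.aemeasurable
  have h1 : charFun (symmetrization ν) s = ((‖charFun ν s‖ ^ 2 : ℝ) : ℂ) := by
    have hmap : charFun (ν.map Neg.neg) s = charFun ν (-s) := by
      have := charFun_map_mul (μ := ν) (-1) s
      simpa [Function.comp_def, neg_one_mul, show (fun x : ℝ => -x) = Neg.neg from rfl] using this
    rw [symmetrization, charFun_conv, hmap, charFun_neg, Complex.mul_conj, Complex.normSq_eq_norm_sq]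
  have h2 := congrArg Complex.re h1
  rw [Complex.ofReal_re] at h2
  rw [← h2, charFun_apply_real]
  have hint : Integrable (fun x : ℝ => Complex.exp (s * x * Complex.I)) (symmetrization ν) := by
    refine Integrable.of_bound (by fun_prop) 1 (.of_forall fun x => ?_)
    rw [show (s : ℂ) * x * Complex.I = ((s * x : ℝ) : ℂ) * Complex.I by push_cast; ring,
      Complex.norm_exp_ofReal_mul_I]
  have := integral_re hint
  simp only [RCLike.re_eq_complex_re] at this
  rw [← this]
  refine integral_congr_ae (.of_forall fun x => ?_)
  simp only
  rw [show (s : ℂ) * x * Complex.I = ((x * s : ℝ) : ℂ) * Complex.I by push_cast; ring,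
      Complex.exp_ofReal_mul_I_re]

lemma norm_charFun_le_exp_neg_integral (ν : Measure ℝ) [IsProbabilityMeasure ν] (s : ℝ) :
    ‖charFun ν s‖ ≤ Real.exp
      (-4 * ∫ x, ‖((x * s / (2 * Real.pi) : ℝ) : UnitAddCircle)‖ ^ 2 ∂(symmetrization ν)) := by
  have hcirc : Integrable (fun x : ℝ => ‖((x * s / (2 * Real.pi) : ℝ) : UnitAddCircle)‖ ^ 2)
      (symmetrization ν) := by
    refine Integrable.of_bound (C := 1) ?_ (.of_forall fun x => ?_)
    · have := continuous_norm_coe_unitAddCircle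
      exact Continuous.aestronglyMeasurable
        ((this.comp (f := fun x : ℝ => x * s / (2 * Real.pi)) (by fun_prop)).pow 2)
    · have := norm_coe_unitAddCircle_le_half (x * s / (2 * Real.pi))
      rw [Real.norm_of_nonneg (by positivity)]
      nlinarith [norm_nonneg ((x * s / (2 * Real.pi) : ℝ) : UnitAddCircle)]
  have hcos : Integrable (fun x : ℝ => Real.cos (x * s)) (symmetrization ν) := by
    refine Integrable.of_bound (C := 1) (by fun_prop) (.of_forall fun x => ?_)
    exact Real.abs_cos_le_one _
  have hmono : 8 * ∫ x, ‖((x * s / (2 * Real.pi) : ℝ) : UnitAddCircle)‖ ^ 2 ∂(symmetrization ν)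
      ≤ 1 - ‖charFun ν s‖ ^ 2 := by
    rw [sq_norm_charFun_eq_integral_cos, ← integral_const_mul]
    calc _ ≤ ∫ x, (1 - Real.cos (x * s)) ∂(symmetrization ν) :=
          integral_mono (hcirc.const_mul 8) ((integrable_const 1).sub hcos)
            fun x => eight_mul_sq_norm_le_one_sub_cos (x * s)
      _ = _ := by rw [integral_sub (integrable_const 1) hcos]; simp
  refine le_of_sq_le_sq ?_ (Real.exp_pos _).le
  rw [← Real.exp_nat_mul]
  have := Real.add_one_le_exp (-(1 - ‖charFun ν s‖ ^ 2))
  refine (show _ ≤ Real.exp (-(1 - ‖charFun ν s‖ ^ 2)) by linarith).trans ?_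
  apply Real.exp_le_exp.2
  push_cast
  linarith

lemma le_symmetrization_real_of_concFn1_le (ν : Measure ℝ) [IsProbabilityMeasure ν] {p : ℝ}
    (h : concFn1 ν 1 ≤ 1 - p) : p ≤ (symmetrization ν).real {z | 1 < |z|} := by
  have hprob : IsProbabilityMeasure (ν.map Neg.neg) :=
    Measure.isProbabilityMeasure_map measurable_neg.aemeasurable
  have hball (x : ℝ) : ν (Metric.closedBall x 1) ≤ ENNReal.ofReal (1 - p) := by
    rw [← ENNReal.ofReal_toReal (measure_ne_top ν (Metric.closedBall x 1))]
    refine ENNReal.ofReal_le_ofReal (le_trans ?_ h)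
    refine le_ciSup (f := fun x : ℝ => (ν (Metric.closedBall x 1)).toReal) ⟨1, ?_⟩ x
    rintro _ ⟨y, rfl⟩
    exact measureReal_le_one
  have hp : 0 ≤ 1 - p := le_trans (Real.iSup_nonneg fun _ => ENNReal.toReal_nonneg) h
  have hmeas : MeasurableSet {z : ℝ | |z| ≤ 1} := measurableSet_le (by fun_prop) (by fun_prop)
  have hle : symmetrization ν {z | |z| ≤ 1} ≤ ENNReal.ofReal (1 - p) := by
    rw [symmetrization, ← lintegral_indicator_one hmeas, Measure.lintegral_conv
      (measurable_one.indicator hmeas)]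
    calc _ = ∫⁻ x, ν (Metric.closedBall x 1) ∂ν := by
          refine lintegral_congr fun x => ?_
          refine (lintegral_map (((measurable_one (α := ENNReal)).indicator hmeas).comp
            (measurable_const_add x)) measurable_neg).trans ?_
          rw [← lintegral_indicator_one Metric.isClosed_closedBall.measurableSet]
          refine lintegral_congr fun y => ?_
          have hiff : x + -y ∈ {z : ℝ | |z| ≤ 1} ↔ y ∈ Metric.closedBall x 1 := by
            simp [Real.dist_eq, ← sub_eq_add_neg, abs_sub_comm x y]
          rw [Function.comp_apply]
          by_cases hy : y ∈ Metric.closedBall x 1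
          · rw [Set.indicator_of_mem hy, Set.indicator_of_mem (hiff.2 hy)]
            rfl
          · rw [Set.indicator_of_notMem hy, Set.indicator_of_notMem (mt hiff.1 hy)]
      _ ≤ ∫⁻ _, ENNReal.ofReal (1 - p) ∂ν := lintegral_mono hball
      _ = _ := by simp
  have hreal : (symmetrization ν).real {z | |z| ≤ 1} ≤ 1 - p := ENNReal.toReal_le_of_le_ofReal hp hle
  have hcompl : {z : ℝ | 1 < |z|} = {z : ℝ | |z| ≤ 1}ᶜ := by ext; simp
  rw [hcompl, probReal_compl_eq_one_sub hmeas]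
  linarith

lemma exp_neg_integral_le_integral_cond {Ω : Type*} [MeasurableSpace Ω] (ρ : Measure Ω)
    [IsProbabilityMeasure ρ] {A : Set Ω} {p : ℝ} (hp : 0 < p)
    (hpA : p ≤ ρ.real A) {g : Ω → ℝ} (hg : Measurable g) (hg0 : ∀ ω, 0 ≤ g ω) {C : ℝ}
    (hgC : ∀ ω, g ω ≤ C) :
    Real.exp (-4 * ∫ ω, g ω ∂ρ) ≤ ∫ ω, Real.exp (-4 * p * g ω) ∂(ρ[|A]) := by
  have hA0 : ρ A ≠ 0 := fun h0 => by
    have : ρ.real A = 0 := by simp [Measure.real, h0]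
    linarith
  have := cond_isProbabilityMeasure hA0
  have hint (μ : Measure Ω) [IsProbabilityMeasure μ] : Integrable g μ :=
    Integrable.of_bound hg.aestronglyMeasurable C
      (.of_forall fun ω => by rw [Real.norm_of_nonneg (hg0 ω)]; exact hgC ω)
  have hcond : p * ∫ ω, g ω ∂(ρ[|A]) ≤ ∫ ω, g ω ∂ρ := by
    have h1 : ∫ ω, g ω ∂(ρ[|A]) = (ρ.real A)⁻¹ * ∫ ω in A, g ω ∂ρ := by
      rw [ProbabilityTheory.cond, integral_smul_measure]
      simp [Measure.real]
    have h2 : ∫ ω in A, g ω ∂ρ ≤ ∫ ω, g ω ∂ρ :=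
      setIntegral_le_integral (hint ρ) (.of_forall hg0)
    have h3 : 0 ≤ ∫ ω in A, g ω ∂ρ := integral_nonneg hg0
    have hpos : 0 < ρ.real A := hp.trans_le hpA
    rw [h1]
    calc p * ((ρ.real A)⁻¹ * ∫ ω in A, g ω ∂ρ)
        = (p / ρ.real A) * ∫ ω in A, g ω ∂ρ := by ring
      _ ≤ 1 * ∫ ω in A, g ω ∂ρ := by
          gcongr
          exact (div_le_one hpos).2 hpA
      _ ≤ _ := by linarith
  calc Real.exp (-4 * ∫ ω, g ω ∂ρ) ≤ Real.exp (∫ ω, -4 * p * g ω ∂(ρ[|A])) := by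
        rw [integral_const_mul]
        apply Real.exp_le_exp.2
        linarith
    _ ≤ _ := by
        refine convexOn_exp.map_integral_le (f := fun ω => -4 * p * g ω)
          Real.continuous_exp.continuousOn isClosed_univ
          (by simp) ((hint _).const_mul _) ?_
        refine Integrable.of_bound (C := 1)
          (Real.measurable_exp.comp (hg.const_mul _)).aestronglyMeasurable (.of_forall fun ω => ?_)
        simp only [Function.comp_apply, Real.norm_eq_abs, Real.abs_exp, Real.exp_le_one_iff]
        nlinarith [mul_nonneg hp.le (hg0 ω)]

/-- The squared distance of `u` to the integer lattice. -/
noncomputable def sqDistInt {n : ℕ} (u : Fin n → ℝ) : ℝ := ∑ k, ‖(u k : UnitAddCircle)‖ ^ 2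

lemma continuous_sqDistInt {n : ℕ} : Continuous (sqDistInt (n := n)) := by
  unfold sqDistInt
  have := continuous_norm_coe_unitAddCircle
  exact continuous_finsetSum _ fun k _ => (this.comp (continuous_apply k)).pow 2

lemma sqDistInt_nonneg {n : ℕ} (u : Fin n → ℝ) : 0 ≤ sqDistInt u :=
  Finset.sum_nonneg fun _ _ => by positivity

lemma sqDistInt_le {n : ℕ} (u : Fin n → ℝ) : sqDistInt u ≤ n := by
  calc sqDistInt u ≤ ∑ _k : Fin n, (1 : ℝ) := by
        refine Finset.sum_le_sum fun k _ => ?_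
        have := norm_coe_unitAddCircle_le_half (u k)
        nlinarith [norm_nonneg (u k : UnitAddCircle)]
    _ = n := by simp

lemma charFun_sumLaw {d n : ℕ} (ν : Measure ℝ) [IsProbabilityMeasure ν]
    (a : Fin n → EuclideanSpace ℝ (Fin d)) (t : EuclideanSpace ℝ (Fin d)) :
    charFun (sumLaw ν a) t = ∏ k, charFun ν ⟪t, a k⟫ := by
  rw [charFun_apply, sumLaw, integral_map (Measurable.aemeasurable (by fun_prop)) (by fun_prop)]
  simp_rw [charFun_apply_real]
  rw [← integral_fintype_prod_eq_prod
    (f := fun (k : Fin n) (x : ℝ) => Complex.exp ((⟪t, a k⟫ : ℝ) * x * Complex.I))]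
  refine integral_congr_ae (.of_forall fun ω => ?_)
  simp only
  rw [← Complex.exp_sum, sum_inner]
  congr 1
  push_cast
  rw [Finset.sum_mul]
  refine Finset.sum_congr rfl fun k _ => ?_
  rw [real_inner_smul_left, real_inner_comm]
  push_cast
  ring

lemma norm_charFun_sumLaw_le {d n : ℕ} (ν : Measure ℝ) [IsProbabilityMeasure ν] {p : ℝ}
    (hp : 0 < p) (h : concFn1 ν 1 ≤ 1 - p) (a : Fin n → EuclideanSpace ℝ (Fin d))
    (t : EuclideanSpace ℝ (Fin d)) :
    ‖charFun (sumLaw ν a) t‖ ≤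
      ∫ z, Real.exp (-4 * p * sqDistInt fun k => z * ⟪t, a k⟫ / (2 * Real.pi))
        ∂((symmetrization ν)[|{z | 1 < |z|}]) := by
  have hcont : Continuous fun z : ℝ => sqDistInt fun k => z * ⟪t, a k⟫ / (2 * Real.pi) :=
    continuous_sqDistInt.comp (by fun_prop)
  refine le_trans ?_ (exp_neg_integral_le_integral_cond (symmetrization ν) hp
    (le_symmetrization_real_of_concFn1_le ν h) hcont.measurable (fun _ => sqDistInt_nonneg _)
    fun _ => sqDistInt_le _)
  rw [charFun_sumLaw, norm_prod]
  unfold sqDistInt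
  rw [integral_finsetSum, Finset.mul_sum, Real.exp_sum]
  · exact Finset.prod_le_prod (fun _ _ => norm_nonneg _)
      fun k _ => norm_charFun_le_exp_neg_integral ν _
  · intro k _
    refine Integrable.of_bound (C := 1) ?_ (.of_forall fun x => ?_)
    · have := continuous_norm_coe_unitAddCircle
      exact Continuous.aestronglyMeasurable
        ((this.comp (f := fun x : ℝ => x * ⟪t, a k⟫ / (2 * Real.pi)) (by fun_prop)).pow 2)
    · have := norm_coe_unitAddCircle_le_half (x * ⟪t, a k⟫ / (2 * Real.pi))
      rw [Real.norm_of_nonneg (by positivity)]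
      nlinarith [norm_nonneg ((x * ⟪t, a k⟫ / (2 * Real.pi) : ℝ) : UnitAddCircle)]

end CharacteristicFunction

section Packing

lemma card_sub_one_mul_sq_le_of_separated {ι H : Type*} [Fintype ι] [NormedAddCommGroup H]
    [InnerProductSpace ℝ H] (v : ι → H) {α M : ℝ} (hα : 0 ≤ α)
    (hsep : Pairwise fun i j => α ≤ ‖v i - v j‖) (hM : ∀ i, ‖v i‖ ^ 2 ≤ M) :
    ((Fintype.card ι : ℝ) - 1) * α ^ 2 ≤ 2 * Fintype.card ι * M := by
  classical
  set N : ℝ := (Fintype.card ι : ℝ) with hN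
  have hN0 : 0 ≤ N := Nat.cast_nonneg _
  have hsum : ∑ i, ∑ j, ‖v i - v j‖ ^ 2 = 2 * N * ∑ i, ‖v i‖ ^ 2 - 2 * ‖∑ i, v i‖ ^ 2 := by
    have h1 : ‖∑ i, v i‖ ^ 2 = ∑ i, ∑ j, ⟪v i, v j⟫ := by
      rw [← real_inner_self_eq_norm_sq, sum_inner]
      simp_rw [inner_sum]
    simp_rw [norm_sub_sq_real, Finset.sum_add_distrib, Finset.sum_sub_distrib, h1,
      ← Finset.mul_sum]
    simp only [Finset.sum_const, Finset.card_univ, nsmul_eq_mul, ← Finset.mul_sum, ← hN]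
    ring
  have hlow : N * ((N - 1) * α ^ 2) ≤ ∑ i, ∑ j, ‖v i - v j‖ ^ 2 := by
    have hi (i : ι) : (N - 1) * α ^ 2 ≤ ∑ j, ‖v i - v j‖ ^ 2 := by
      rw [← Finset.add_sum_erase _ _ (Finset.mem_univ i)]
      have hcard : ((Finset.univ.erase i).card : ℝ) = N - 1 := by
        rw [Finset.cast_card_erase_of_mem (Finset.mem_univ i), Finset.card_univ]
      have : (Finset.univ.erase i).card • α ^ 2 ≤ ∑ j ∈ Finset.univ.erase i, ‖v i - v j‖ ^ 2 := by
        refine Finset.card_nsmul_le_sum _ _ _ fun j hj => ?_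
        have := hsep (Finset.ne_of_mem_erase hj).symm
        gcongr
      rw [nsmul_eq_mul, hcard] at this
      nlinarith [sq_nonneg ‖v i - v i‖]
    have := Finset.card_nsmul_le_sum Finset.univ _ _ fun i _ => hi i
    rwa [nsmul_eq_mul, Finset.card_univ] at this
  have hup : ∑ i, ‖v i‖ ^ 2 ≤ N * M := by
    have := Finset.sum_le_card_nsmul Finset.univ _ _ fun i _ => hM i
    rwa [nsmul_eq_mul, Finset.card_univ] at this
  rcases hN0.eq_or_lt with h0 | hpos
  · rw [← h0]
    nlinarith [sq_nonneg α]
  · refine le_of_mul_le_mul_left ?_ hpos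
    nlinarith [sq_nonneg ‖∑ i, v i‖]

lemma exists_greedy_minimizers {V : Type*} [PseudoMetricSpace V] [Nonempty V] {K : Set V}
    (hK : IsCompact K) {f : V → ℝ} (hf : ContinuousOn f K) (r : ℝ) :
    ∃ (S : ℕ → Set V) (x : ℕ → V), S 0 = K ∧ (∀ i, S (i + 1) = S i \ Metric.ball (x i) r) ∧
      ∀ i, ∀ y ∈ S i, x i ∈ S i ∧ f (x i) ≤ f y := by
  have hpick (T : Set V) : ∃ x, IsCompact T → T ⊆ K → ∀ y ∈ T, x ∈ T ∧ f x ≤ f y := by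
    by_cases hT : IsCompact T ∧ T ⊆ K ∧ T.Nonempty
    · obtain ⟨x, hx, hmin⟩ := hT.1.exists_isMinOn hT.2.2 (hf.mono hT.2.1)
      exact ⟨x, fun _ _ y hy => ⟨hx, hmin hy⟩⟩
    · exact ⟨Classical.arbitrary V, fun h1 h2 y hy => absurd ⟨h1, h2, y, hy⟩ hT⟩
  choose pick hpick using hpick
  let S : ℕ → Set V := fun i => Nat.rec K (fun _ T => T \ Metric.ball (pick T) r) i
  have hS (i : ℕ) : IsCompact (S i) ∧ S i ⊆ K := by
    induction i with
    | zero => exact ⟨hK, subset_rfl⟩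
    | succ i ih => exact ⟨ih.1.diff Metric.isOpen_ball, Set.sdiff_subset.trans ih.2⟩
  exact ⟨S, fun i => pick (S i), rfl, fun _ => rfl, fun i => hpick _ (hS i).1 (hS i).2⟩

lemma exists_exp_neg_sq_le_sum {V H : Type*} [SeminormedAddCommGroup V] [NormedAddCommGroup H]
    [InnerProductSpace ℝ H] {K : Set V} (hK : IsCompact K) {u : V → H}
    (hu : ContinuousOn (fun y => ‖u y‖ ^ 2) K) {α β p : ℝ} (hα : 0 < α) (hβ : 0 < β) (hp : 0 < p)
    (hsep : ∀ y ∈ K, ∀ y' ∈ K, min (β * ‖y - y'‖) α ≤ ‖u y - u y'‖) (N : ℕ) :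
    ∃ x : ℕ → V, ∀ y ∈ K, Real.exp (-4 * p * ‖u y‖ ^ 2) ≤
      ∑ i ∈ Finset.range N, Real.exp (-p * (i / (i + 1) * α ^ 2)) *
          Real.exp (-(p * β ^ 2 / 2) * ‖y - x i‖ ^ 2)
        + Real.exp (-2 * p * (N / (N + 1) * α ^ 2)) := by
  obtain ⟨S, x, hS0, hSsucc, hmin⟩ := exists_greedy_minimizers hK hu (α / β)
  have hanti : Antitone S := antitone_nat_of_succ_le fun i => by
    rw [hSsucc]
    exact Set.sdiff_subset
  have hSK (i : ℕ) : S i ⊆ K := hS0 ▸ hanti (Nat.zero_le i)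
  have henergy (i : ℕ) (y : V) (hy : y ∈ S i) : i / (i + 1) * α ^ 2 ≤ 2 * ‖u y‖ ^ 2 := by
    let w : Fin (i + 1) → V := fun j => if (j : ℕ) < i then x j else y
    have hw (j : Fin (i + 1)) : w j ∈ S j ∧ ‖u (w j)‖ ^ 2 ≤ ‖u y‖ ^ 2 := by
      have hyj : y ∈ S j := hanti (Nat.lt_succ_iff.1 j.2) hy
      by_cases hj : (j : ℕ) < i
      · simpa [w, hj] using hmin j y hyj
      · simpa [w, hj] using hyj
    have hlt {j k : Fin (i + 1)} (hjk : j < k) : α ≤ ‖u (w j) - u (w k)‖ := by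
      have hji : (j : ℕ) < i := lt_of_lt_of_le hjk (Nat.lt_succ_iff.1 k.2)
      have hk : w k ∈ S (j + 1) := hanti (Nat.succ_le_of_lt hjk) (hw k).1
      rw [hSsucc] at hk
      have hd : α / β ≤ ‖w j - w k‖ := by
        have := hk.2
        rw [Metric.mem_ball, not_lt, dist_comm, dist_eq_norm] at this
        simpa [w, hji] using this
      have h2 : α ≤ β * ‖w j - w k‖ := by
        rw [div_le_iff₀ hβ] at hd
        linarith
      have := hsep _ (hSK _ (hw j).1) _ (hSK _ (hw k).1)
      rwa [min_eq_right h2] at this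
    have := card_sub_one_mul_sq_le_of_separated (fun j => u (w j)) hα.le
      (fun j k hjk => by
        rcases lt_or_gt_of_ne hjk with h | h
        · exact hlt h
        · rw [norm_sub_rev]
          exact hlt h) fun j => (hw j).2
    simp only [Fintype.card_fin] at this
    push_cast at this
    rw [div_mul_eq_mul_div, div_le_iff₀ (by positivity)]
    linarith
  refine ⟨x, fun y hy => ?_⟩
  have hcases (m : ℕ) : (∃ i < m, y ∈ S i ∧ y ∈ Metric.ball (x i) (α / β)) ∨ y ∈ S m := by
    induction m with
    | zero => exact Or.inr (hS0 ▸ hy)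
    | succ m ih =>
      rcases ih with ⟨i, hi, h⟩ | h
      · exact Or.inl ⟨i, by omega, h⟩
      · by_cases hb : y ∈ Metric.ball (x m) (α / β)
        · exact Or.inl ⟨m, by omega, h, hb⟩
        · rw [hSsucc]
          exact Or.inr ⟨h, hb⟩
  rcases hcases N with ⟨i, hi, hyS, hyb⟩ | hyN
  · have hx := hmin i y hyS
    have hE := henergy i (x i) hx.1
    have hd : ‖y - x i‖ < α / β := by rwa [← dist_eq_norm]
    have hd' : β * ‖y - x i‖ ≤ α := by
      rw [lt_div_iff₀ hβ] at hd
      linarith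
    have hs := hsep _ (hSK _ hyS) _ (hSK _ hx.1)
    rw [min_eq_left hd'] at hs
    have hxy : ‖u (x i)‖ ≤ ‖u y‖ := le_of_sq_le_sq hx.2 (norm_nonneg _)
    have h2 : β * ‖y - x i‖ ≤ 2 * ‖u y‖ := by linarith [norm_sub_le (u y) (u (x i))]
    have h3 : (β * ‖y - x i‖) ^ 2 ≤ (2 * ‖u y‖) ^ 2 := by gcongr
    have hterm : Real.exp (-4 * p * ‖u y‖ ^ 2) ≤ Real.exp (-p * (i / (i + 1) * α ^ 2)) *
          Real.exp (-(p * β ^ 2 / 2) * ‖y - x i‖ ^ 2) := by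
      rw [← Real.exp_add]
      apply Real.exp_le_exp.2
      have h4 : i / (i + 1) * α ^ 2 ≤ 2 * ‖u y‖ ^ 2 := by linarith [hx.2]
      nlinarith [mul_le_mul_of_nonneg_left h4 hp.le, mul_le_mul_of_nonneg_left h3 hp.le]
    refine hterm.trans (le_trans ?_ (le_add_of_nonneg_right (Real.exp_pos _).le))
    exact Finset.single_le_sum (f := fun i : ℕ => Real.exp (-p * (i / (i + 1) * α ^ 2)) *
          Real.exp (-(p * β ^ 2 / 2) * ‖y - x i‖ ^ 2)) (fun _ _ => by positivity)
          (Finset.mem_range.2 hi)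
  · have h := henergy N y hyN
    refine le_trans ?_ (le_add_of_nonneg_left (Finset.sum_nonneg fun _ _ => by positivity))
    apply Real.exp_le_exp.2
    nlinarith [mul_le_mul_of_nonneg_left h hp.le]

lemma exists_weight_sum_le {w : ℝ} (hw : 0 < w) :
    ∃ N : ℕ, ∑ i ∈ Finset.range N, Real.exp (-(i / (i + 1) * w)) ≤ 4 ∧
      Real.exp (-2 * (N / (N + 1) * w)) ≤ Real.exp 1 * Real.exp (-2 * w) := by
  refine ⟨⌈2 * w⌉₊, ?_, ?_⟩
  · rcases Nat.eq_zero_or_pos ⌈2 * w⌉₊ with h0 | hpos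
    · simp [h0]
    obtain ⟨m, hm⟩ := Nat.exists_eq_succ_of_ne_zero hpos.ne'
    have hmw : (m : ℝ) ≤ 2 * w := by
      have := Nat.ceil_lt_add_one (show 0 ≤ 2 * w by positivity)
      rw [hm] at this
      push_cast at this
      linarith
    rw [hm, Finset.sum_range_succ']
    have hterm : ∀ i ∈ Finset.range m,
        Real.exp (-(((i + 1 : ℕ) : ℝ) / ((i + 1 : ℕ) + 1) * w)) ≤ Real.exp (-(w / 2)) := by
      intro i _
      apply Real.exp_le_exp.2
      have : (1 : ℝ) / 2 ≤ ((i + 1 : ℕ) : ℝ) / ((i + 1 : ℕ) + 1) := by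
        rw [div_le_div_iff₀ (by norm_num) (by positivity)]
        push_cast
        linarith [(Nat.cast_nonneg i : (0 : ℝ) ≤ i)]
      nlinarith
    have hsum := Finset.sum_le_card_nsmul _ _ _ hterm
    rw [Finset.card_range, nsmul_eq_mul] at hsum
    have hexp : w / 2 * Real.exp (-(w / 2)) ≤ Real.exp (-1) := Real.mul_exp_neg_le_exp_neg_one _
    have hexp1 : Real.exp (-1) ≤ 1 / 2 := by
      rw [Real.exp_neg, one_div]
      gcongr
      linarith [Real.add_one_le_exp 1]
    have : (m : ℝ) * Real.exp (-(w / 2)) ≤ 2 * w * Real.exp (-(w / 2)) := by gcongr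
    simp only [Nat.cast_zero, zero_div, zero_mul, neg_zero, Real.exp_zero]
    linarith
  · rw [← Real.exp_add]
    apply Real.exp_le_exp.2
    have hN := Nat.le_ceil (2 * w)
    have hpos : (0 : ℝ) < (⌈2 * w⌉₊ : ℝ) + 1 := by positivity
    have : (⌈2 * w⌉₊ : ℝ) / (⌈2 * w⌉₊ + 1) = 1 - 1 / (⌈2 * w⌉₊ + 1) := by field_simp; ring
    rw [this]
    have h2 : 2 * w * (1 / ((⌈2 * w⌉₊ : ℝ) + 1)) ≤ 1 := by
      rw [mul_one_div, div_le_one hpos]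
      linarith
    linarith

end Packing

section FourierSmoothing

lemma lintegral_exp_neg_mul_sq_norm {V : Type*} [NormedAddCommGroup V] [InnerProductSpace ℝ V]
    [FiniteDimensional ℝ V] [MeasurableSpace V] [BorelSpace V] {b : ℝ} (hb : 0 < b) :
    ∫⁻ v : V, ENNReal.ofReal (Real.exp (-b * ‖v‖ ^ 2)) =
      ENNReal.ofReal (Real.sqrt (Real.pi / b) ^ Module.finrank ℝ V) := by
  have hval := GaussianFourier.integral_rexp_neg_mul_sq_norm (V := V) hb
  rw [Real.rpow_div_two_eq_sqrt _ (by positivity), Real.rpow_natCast] at hval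
  rw [← hval, ofReal_integral_eq_lintegral_ofReal _ (.of_forall fun _ => (Real.exp_pos _).le)]
  refine (GaussianFourier.integrable_cexp_neg_mul_sq_norm_add (V := V) (b := b)
    (by simpa using hb) 0 0).norm.congr (.of_forall fun v => ?_)
  simp only [Complex.norm_exp, inner_zero_left, Complex.ofReal_zero, mul_zero, add_zero]
  norm_cast

/-- Esseen's inequality with a Gaussian weight. -/
lemma measure_closedBall_le_lintegral_charFun {V : Type*} [NormedAddCommGroup V]
    [InnerProductSpace ℝ V] [FiniteDimensional ℝ V] [MeasurableSpace V] [BorelSpace V]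
    (μ : Measure V) [IsProbabilityMeasure μ] {b r : ℝ} (hb : 0 < b) (x₀ : V) :
    μ (Metric.closedBall x₀ r) ≤
      ENNReal.ofReal (Real.exp (r ^ 2 / (4 * b)) * Real.sqrt (b / Real.pi) ^ Module.finrank ℝ V) *
        ∫⁻ t, ENNReal.ofReal (Real.exp (-b * ‖t‖ ^ 2)) * ENNReal.ofReal ‖charFun μ t‖ := by
  set J : ℝ := ∫ y, Real.exp (-‖y - x₀‖ ^ 2 / (4 * b)) ∂μ with hJ
  set G : ℝ := Real.sqrt (Real.pi / b) ^ Module.finrank ℝ V with hG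
  have hintJ : Integrable (fun y => Real.exp (-‖y - x₀‖ ^ 2 / (4 * b))) μ := by
    refine Integrable.of_bound (C := 1) (by fun_prop) (.of_forall fun y => ?_)
    rw [Real.norm_of_nonneg (Real.exp_pos _).le, Real.exp_le_one_iff]
    exact div_nonpos_of_nonpos_of_nonneg (by simp) (by positivity)
  have hball : μ.real (Metric.closedBall x₀ r) ≤ Real.exp (r ^ 2 / (4 * b)) * J := by
    rw [← integral_indicator_one Metric.isClosed_closedBall.measurableSet, hJ,
      ← integral_const_mul]
    refine integral_mono ((integrable_const 1).indicator
      Metric.isClosed_closedBall.measurableSet) (hintJ.const_mul _) fun y => ?_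
    by_cases hy : y ∈ Metric.closedBall x₀ r
    · rw [Set.indicator_of_mem hy, Pi.one_apply, ← Real.exp_add, Real.one_le_exp_iff, ← add_div]
      rw [Metric.mem_closedBall, dist_eq_norm] at hy
      have : ‖y - x₀‖ ^ 2 ≤ r ^ 2 := by gcongr
      apply div_nonneg _ (by positivity)
      linarith
    · rw [Set.indicator_of_notMem hy]
      positivity
  have hnorm (y t : V) : ‖Complex.exp (-(b : ℂ) * ‖t‖ ^ 2 + Complex.I * (⟪y - x₀, t⟫ : ℝ))‖ =
      Real.exp (-b * ‖t‖ ^ 2) := by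
    rw [Complex.norm_exp]
    congr 1
    simp only [Complex.add_re, Complex.I_mul_re, Complex.ofReal_im, neg_zero, add_zero]
    norm_cast
  have hgauss : Integrable (fun t : V => Real.exp (-b * ‖t‖ ^ 2)) :=
    (GaussianFourier.integrable_cexp_neg_mul_sq_norm_add (V := V) (b := b)
      (by simpa using hb) Complex.I (x₀ - x₀)).norm.congr (.of_forall fun t => hnorm x₀ t)
  have hprod : Integrable (Function.uncurry fun y t : V =>
      Complex.exp (-(b : ℂ) * ‖t‖ ^ 2 + Complex.I * (⟪y - x₀, t⟫ : ℝ))) (μ.prod volume) := by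
    refine (hgauss.comp_snd μ).mono' ?_ (.of_forall fun q => (hnorm q.1 q.2).le)
    refine Continuous.aestronglyMeasurable ?_
    unfold Function.uncurry
    fun_prop
  have hswap := integral_integral_swap hprod
  have hleft :
      ∫ y, (∫ t : V, Complex.exp (-(b : ℂ) * ‖t‖ ^ 2 + Complex.I * (⟪y - x₀, t⟫ : ℝ))) ∂μ =
      ((G * J : ℝ) : ℂ) := by
    rw [hJ, ← integral_const_mul, ← integral_complex_ofReal]
    refine integral_congr_ae (.of_forall fun y => ?_)
    simp only
    rw [GaussianFourier.integral_cexp_neg_mul_sq_norm_add (by simpa using hb), Complex.I_sq,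
      Complex.ofReal_mul]
    congr 1
    · rw [hG, ← Real.rpow_natCast, ← Real.rpow_div_two_eq_sqrt _ (by positivity),
        Complex.ofReal_cpow (by positivity)]
      push_cast
      rfl
    · push_cast
      ring_nf
  have hright (t : V) :
      ∫ y, Complex.exp (-(b : ℂ) * ‖t‖ ^ 2 + Complex.I * (⟪y - x₀, t⟫ : ℝ)) ∂μ =
      Complex.exp (-(b : ℂ) * ‖t‖ ^ 2 + Complex.I * (⟪0 - x₀, t⟫ : ℝ)) * charFun μ t := by
    rw [charFun_apply, ← integral_const_mul]
    refine integral_congr_ae (.of_forall fun y => ?_)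
    simp only
    rw [← Complex.exp_add, inner_sub_left, inner_sub_left, inner_zero_left]
    push_cast
    ring_nf
  have hGpos : 0 < G := by positivity
  have hJpos : 0 ≤ J := integral_nonneg fun _ => (Real.exp_pos _).le
  have hGJ : ENNReal.ofReal (G * J) ≤
      ∫⁻ t, ENNReal.ofReal (Real.exp (-b * ‖t‖ ^ 2)) * ENNReal.ofReal ‖charFun μ t‖ := by
    rw [hleft] at hswap
    calc ENNReal.ofReal (G * J) = ‖((G * J : ℝ) : ℂ)‖ₑ := by
          rw [← ofReal_norm, Complex.norm_real, Real.norm_of_nonneg (by positivity)]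
      _ ≤ _ := by
          rw [hswap]
          refine (enorm_integral_le_lintegral_enorm _).trans (lintegral_mono fun t => ?_)
          rw [hright, ← ofReal_norm, norm_mul, hnorm,
            ENNReal.ofReal_mul (Real.exp_pos _).le]
  have hinv : Real.sqrt (b / Real.pi) ^ Module.finrank ℝ V * G = 1 := by
    rw [hG, ← mul_pow, ← Real.sqrt_mul (by positivity)]
    have : b / Real.pi * (Real.pi / b) = 1 := by
      have := Real.pi_pos
      field_simp
    simp [this]
  calc μ (Metric.closedBall x₀ r) = ENNReal.ofReal (μ.real (Metric.closedBall x₀ r)) := by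
        rw [ofReal_measureReal]
    _ ≤ ENNReal.ofReal ((Real.exp (r ^ 2 / (4 * b)) *
          Real.sqrt (b / Real.pi) ^ Module.finrank ℝ V) * (G * J)) := by
        apply ENNReal.ofReal_le_ofReal
        calc _ ≤ _ := hball
          _ = Real.exp (r ^ 2 / (4 * b)) * (Real.sqrt (b / Real.pi) ^ Module.finrank ℝ V * G) * J := by
              rw [hinv, mul_one]
          _ = _ := by ring
    _ ≤ _ := by
        rw [ENNReal.ofReal_mul (by positivity)]
        gcongr

lemma lintegral_gaussian_mul_le_of_local_average {V : Type*} [NormedAddCommGroup V]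
    [InnerProductSpace ℝ V] [FiniteDimensional ℝ V] [MeasurableSpace V] [BorelSpace V]
    {b ρ : ℝ} (hb : 0 < b) (hρ : 0 < ρ) {F : V → ENNReal} (hF : Measurable F) {M : ENNReal}
    (hM : ∀ x, ∫⁻ u in Metric.closedBall (0 : V) ρ, F (x + u) ≤
      M * volume (Metric.closedBall (0 : V) ρ)) :
    ∫⁻ y, ENNReal.ofReal (Real.exp (-b * ‖y‖ ^ 2)) * F y ≤
      ENNReal.ofReal (Real.exp (b * ρ ^ 2) *
        Real.sqrt (2 * Real.pi / b) ^ Module.finrank ℝ V) * M := by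
  set E := Metric.closedBall (0 : V) ρ with hE
  have hE0 : volume E ≠ 0 := (Metric.measure_closedBall_pos volume 0 hρ).ne'
  have hEtop : volume E ≠ ⊤ := measure_closedBall_lt_top.ne
  have hEm : MeasurableSet E := Metric.isClosed_closedBall.measurableSet
  let g : V → ENNReal := fun x => ENNReal.ofReal (Real.exp (-(b / 2) * ‖x‖ ^ 2))
  have hg : Measurable g := by fun_prop
  set c : ENNReal := ENNReal.ofReal (Real.exp (b * ρ ^ 2)) with hc
  have hpt (y u : V) (hu : u ∈ E) :
      ENNReal.ofReal (Real.exp (-b * ‖y‖ ^ 2)) ≤ c * g (y - u) := by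
    simp only [g, hc]
    rw [← ENNReal.ofReal_mul (Real.exp_pos _).le, ← Real.exp_add]
    apply ENNReal.ofReal_le_ofReal
    apply Real.exp_le_exp.2
    have h1 : ‖u‖ ≤ ρ := by simpa [hE] using hu
    have h2 : ‖u‖ ^ 2 ≤ ρ ^ 2 := by gcongr
    have h3 := parallelogram_law_with_norm ℝ y u
    have h4 : ‖y - u‖ ^ 2 ≤ 2 * ‖y‖ ^ 2 + 2 * ρ ^ 2 := by nlinarith [norm_nonneg (y + u)]
    nlinarith
  have hmeas1 : Measurable (Function.uncurry fun y u : V => c * g (y - u) * F y) := by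
    unfold Function.uncurry
    fun_prop
  have hmeas2 : Measurable (Function.uncurry fun u x : V => c * g x * F (x + u)) := by
    unfold Function.uncurry
    fun_prop
  have key : volume E * ∫⁻ y, ENNReal.ofReal (Real.exp (-b * ‖y‖ ^ 2)) * F y ≤
      volume E * (c * (∫⁻ x, g x) * M) := by
    calc _ = ∫⁻ y, ∫⁻ _ in E, ENNReal.ofReal (Real.exp (-b * ‖y‖ ^ 2)) * F y := by
          rw [← lintegral_const_mul' _ _ hEtop]
          refine lintegral_congr fun y => ?_
          rw [setLIntegral_const, mul_comm]
      _ ≤ ∫⁻ y, ∫⁻ u in E, c * g (y - u) * F y := by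
          refine lintegral_mono fun y => setLIntegral_mono' hEm fun u hu => ?_
          gcongr
          exact hpt y u hu
      _ = ∫⁻ u in E, ∫⁻ y, c * g (y - u) * F y := lintegral_lintegral_swap hmeas1.aemeasurable
      _ = ∫⁻ u in E, ∫⁻ x, c * g x * F (x + u) := by
          refine lintegral_congr fun u => ?_
          rw [← lintegral_add_right_eq_self _ u]
          simp
      _ = ∫⁻ x, ∫⁻ u in E, c * g x * F (x + u) := lintegral_lintegral_swap hmeas2.aemeasurable
      _ = ∫⁻ x, c * g x * ∫⁻ u in E, F (x + u) := by
          refine lintegral_congr fun x => ?_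
          rw [lintegral_const_mul _ (by fun_prop)]
      _ ≤ ∫⁻ x, c * g x * (M * volume E) := by
          refine lintegral_mono fun x => ?_
          gcongr
          exact hM x
      _ = _ := by
          rw [lintegral_mul_const _ (by fun_prop), lintegral_const_mul _ hg]
          ring
  have hfin := (ENNReal.mul_le_mul_iff_right hE0 hEtop).1 key
  refine hfin.trans_eq ?_
  rw [ENNReal.ofReal_mul (Real.exp_pos _).le]
  congr 2
  rw [lintegral_exp_neg_mul_sq_norm (by positivity)]
  congr 3
  field_simp

lemma ofReal_pow_le_volume_closedBall {d : ℕ} (hd : 0 < d) {ρ : ℝ} (hρ : 0 ≤ ρ) :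
    ENNReal.ofReal ((2 * ρ / Real.sqrt d) ^ d) ≤
      volume (Metric.closedBall (0 : EuclideanSpace ℝ (Fin d)) ρ) := by
  have hs : 0 < Real.sqrt d := Real.sqrt_pos.2 (by exact_mod_cast hd)
  set s : ℝ := ρ / Real.sqrt d with hsdef
  have hs0 : 0 ≤ s := by positivity
  have hbox : volume (Set.Icc (fun _ : Fin d => -s) fun _ => s) =
      ENNReal.ofReal ((2 * ρ / Real.sqrt d) ^ d) := by
    rw [Real.volume_Icc_pi, Finset.prod_const, Finset.card_univ, Fintype.card_fin,
      ENNReal.ofReal_pow (by positivity)]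
    congr 2
    rw [hsdef]
    ring
  rw [← hbox, ← (EuclideanSpace.volume_preserving_symm_measurableEquiv_toLp
    (Fin d)).measure_preimage_equiv]
  refine measure_mono fun y hy => ?_
  have hy' : ∀ i, |y i| ≤ s := fun i => abs_le.2 ⟨hy.1 i, hy.2 i⟩
  rw [mem_closedBall_zero_iff]
  refine le_of_sq_le_sq ?_ hρ
  rw [EuclideanSpace.norm_sq_eq]
  calc ∑ i, ‖y i‖ ^ 2 ≤ ∑ _i : Fin d, s ^ 2 := by
        refine Finset.sum_le_sum fun i _ => ?_
        rw [Real.norm_eq_abs]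
        have := hy' i
        gcongr
    _ = d * s ^ 2 := by simp
    _ = ρ ^ 2 := by
        rw [hsdef, div_pow, Real.sq_sqrt (Nat.cast_nonneg d)]
        field_simp

end FourierSmoothing

section ConcentrationBound

lemma lintegral_exp_neg_sqDistInt_le {d n : ℕ} (hd : 0 < d) {p α D γ z : ℝ} (hp : 0 < p)
    (a : Fin n → EuclideanSpace ℝ (Fin d))
    (ha : ∀ t : EuclideanSpace ℝ (Fin d), ‖t‖ ^ 2 ≤ ∑ k, ⟪t, a k⟫ ^ 2)
    (hα : 0 < α) (hD : 0 < D) (hγ : 0 < γ)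
    (hlcd : ∀ (m : Fin n → ℤ) (t : EuclideanSpace ℝ (Fin d)), ‖t‖ ≤ D →
      min (γ * Real.sqrt (∑ k, ⟪t, a k⟫ ^ 2)) α ≤ Real.sqrt (∑ k, (⟪t, a k⟫ - m k) ^ 2))
    (hz : 0 < |z|) (x : EuclideanSpace ℝ (Fin d)) :
    ∫⁻ u in Metric.closedBall (0 : EuclideanSpace ℝ (Fin d)) (D / |z|),
        ENNReal.ofReal (Real.exp
          (-4 * p * sqDistInt fun k => z * ⟪x + u, a k⟫ / (2 * Real.pi))) ≤
      ENNReal.ofReal (4 * (Real.pi * Real.sqrt (2 * Real.pi) *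
          (Real.sqrt d / (γ * D * Real.sqrt p))) ^ d +
        Real.exp 1 * Real.exp (-2 * p * α ^ 2)) *
      volume (Metric.closedBall (0 : EuclideanSpace ℝ (Fin d)) (D / |z|)) := by
  have hpi := Real.pi_pos
  set ρ : ℝ := D / |z| with hρ
  have hρ0 : 0 < ρ := by positivity
  set β : ℝ := γ * (|z| / (2 * Real.pi)) with hβ
  have hβ0 : 0 < β := by positivity
  let v : EuclideanSpace ℝ (Fin d) → Fin n → ℝ := fun y k => z * ⟪y, a k⟫ / (2 * Real.pi)
  let u : EuclideanSpace ℝ (Fin d) → EuclideanSpace ℝ (Fin n) :=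
    fun y => WithLp.toLp 2 fun k => v y k - round (v y k)
  have hu (y : EuclideanSpace ℝ (Fin d)) : ‖u y‖ ^ 2 = sqDistInt (v y) := by
    rw [EuclideanSpace.norm_sq_eq, sqDistInt]
    refine Finset.sum_congr rfl fun k _ => ?_
    rw [UnitAddCircle.norm_eq, Real.norm_eq_abs]
  have hvcont : Continuous v := by fun_prop
  have hsep : ∀ y ∈ Metric.closedBall x ρ, ∀ y' ∈ Metric.closedBall x ρ,
      min (β * ‖y - y'‖) α ≤ ‖u y - u y'‖ := by
    intro y hy y' hy'
    set t : EuclideanSpace ℝ (Fin d) := (z / (2 * Real.pi)) • (y - y') with ht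
    have htnorm : ‖t‖ = |z| / (2 * Real.pi) * ‖y - y'‖ := by
      rw [ht, norm_smul, Real.norm_eq_abs, abs_div, abs_of_pos (by positivity : 0 < 2 * Real.pi)]
    have hyy : ‖y - y'‖ ≤ 2 * ρ := by
      rw [← dist_eq_norm]
      linarith [dist_triangle_right y y' x, Metric.mem_closedBall.1 hy, Metric.mem_closedBall.1 hy']
    have htD : ‖t‖ ≤ D := by
      rw [htnorm]
      calc |z| / (2 * Real.pi) * ‖y - y'‖ ≤ |z| / (2 * Real.pi) * (2 * ρ) := by gcongr
        _ = D / Real.pi := by rw [hρ]; field_simp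
        _ ≤ D := div_le_self hD.le (by linarith [Real.two_le_pi])
    have hnorm : Real.sqrt (∑ k, (⟪t, a k⟫ - (round (v y k) - round (v y' k) : ℤ)) ^ 2) =
        ‖u y - u y'‖ := by
      rw [EuclideanSpace.norm_eq]
      congr 1
      refine Finset.sum_congr rfl fun k _ => ?_
      rw [Real.norm_eq_abs, sq_abs]
      simp only [u, v, ht, PiLp.sub_apply, real_inner_smul_left, inner_sub_left]
      push_cast
      ring
    rw [← hnorm]
    refine le_trans (min_le_min_right _ ?_) (hlcd _ t htD)
    calc β * ‖y - y'‖ = γ * ‖t‖ := by rw [htnorm, hβ]; ring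
      _ ≤ _ := by
        gcongr
        exact Real.le_sqrt_of_sq_le (ha t)
  obtain ⟨N, hN1, hN2⟩ := exists_weight_sum_le (show 0 < p * α ^ 2 by positivity)
  obtain ⟨xs, hxs⟩ := exists_exp_neg_sq_le_sum (isCompact_closedBall x ρ) (u := u)
    (by simp_rw [hu]; exact (continuous_sqDistInt.comp hvcont).continuousOn) hα hβ0 hp hsep N
  set q : ℝ := p * β ^ 2 / 2 with hq
  have hq0 : 0 < q := by positivity
  let w : ℕ → ℝ := fun i => Real.exp (-p * (i / (i + 1) * α ^ 2))
  set c : ℝ := Real.exp (-2 * p * (N / (N + 1) * α ^ 2)) with hc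
  have hw : ∑ i ∈ Finset.range N, w i ≤ 4 := by
    refine le_trans (le_of_eq (Finset.sum_congr rfl fun i _ => ?_)) hN1
    simp only [w]
    ring_nf
  have hc' : c ≤ Real.exp 1 * Real.exp (-2 * p * α ^ 2) := by
    refine le_trans (le_of_eq ?_) (hN2.trans (le_of_eq ?_))
    · rw [hc]
      ring_nf
    · ring_nf
  set E := Metric.closedBall (0 : EuclideanSpace ℝ (Fin d)) ρ with hE
  have hpt : ∀ y ∈ E, ENNReal.ofReal (Real.exp (-4 * p * sqDistInt (v (x + y)))) ≤
      ∑ i ∈ Finset.range N, ENNReal.ofReal (w i) *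
        ENNReal.ofReal (Real.exp (-q * ‖y + (x - xs i)‖ ^ 2)) + ENNReal.ofReal c := by
    intro y hy
    have hmem : x + y ∈ Metric.closedBall x ρ := by
      simpa [hE, dist_eq_norm] using hy
    have h := hxs (x + y) hmem
    rw [hu] at h
    refine (ENNReal.ofReal_le_ofReal h).trans ?_
    rw [ENNReal.ofReal_add (Finset.sum_nonneg fun _ _ => by positivity) (by positivity),
      ENNReal.ofReal_sum_of_nonneg fun _ _ => by positivity]
    gcongr with i
    rw [ENNReal.ofReal_mul (by positivity), show x + y - xs i = y + (x - xs i) by abel]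
  set T : ℝ := Real.sqrt (Real.pi / q) ^ d with hT
  have hterm (i : ℕ) : ∫⁻ y in E, ENNReal.ofReal (Real.exp (-q * ‖y + (x - xs i)‖ ^ 2)) ≤
      ENNReal.ofReal T := by
    refine (setLIntegral_le_lintegral _ _).trans ?_
    rw [lintegral_add_right_eq_self
      (fun y => ENNReal.ofReal (Real.exp (-q * ‖y‖ ^ 2))) (x - xs i),
      lintegral_exp_neg_mul_sq_norm hq0, finrank_euclideanSpace_fin]
  set A : ℝ := Real.pi * Real.sqrt (2 * Real.pi) * (Real.sqrt d / (γ * D * Real.sqrt p)) with hA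
  have hvol : ENNReal.ofReal T ≤ ENNReal.ofReal (A ^ d) * volume E := by
    refine le_trans ?_ (mul_le_mul_right (ofReal_pow_le_volume_closedBall hd hρ0.le) _)
    rw [← ENNReal.ofReal_mul (by positivity), ← mul_pow, hT]
    apply le_of_eq
    congr 2
    have hs : 0 < Real.sqrt d := Real.sqrt_pos.2 (by exact_mod_cast hd)
    have hsp : 0 < Real.sqrt p := Real.sqrt_pos.2 hp
    rw [Real.sqrt_eq_iff_mul_self_eq (by positivity) (by positivity), hA, hq, hβ, hρ]
    have h1 : Real.sqrt (2 * Real.pi) ^ 2 = 2 * Real.pi := Real.sq_sqrt (by positivity)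
    have h2 : Real.sqrt p ^ 2 = p := Real.sq_sqrt hp.le
    field_simp
    rw [h2, mul_comm Real.pi 2, h1]
    ring
  calc _ ≤ ∫⁻ y in E, (∑ i ∈ Finset.range N, ENNReal.ofReal (w i) *
        ENNReal.ofReal (Real.exp (-q * ‖y + (x - xs i)‖ ^ 2)) + ENNReal.ofReal c) :=
        setLIntegral_mono' Metric.isClosed_closedBall.measurableSet hpt
    _ = (∑ i ∈ Finset.range N, ENNReal.ofReal (w i) *
          ∫⁻ y in E, ENNReal.ofReal (Real.exp (-q * ‖y + (x - xs i)‖ ^ 2))) +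
        ENNReal.ofReal c * volume E := by
        rw [lintegral_add_right _ measurable_const, setLIntegral_const,
          lintegral_finsetSum _ (fun i _ => by fun_prop)]
        congr 1
        refine Finset.sum_congr rfl fun i _ => ?_
        rw [lintegral_const_mul _ (by fun_prop)]
    _ ≤ (∑ i ∈ Finset.range N, ENNReal.ofReal (w i) * (ENNReal.ofReal (A ^ d) * volume E)) +
        ENNReal.ofReal c * volume E := by
        gcongr with i
        exact (hterm i).trans hvol
    _ = ENNReal.ofReal ((∑ i ∈ Finset.range N, w i) * A ^ d + c) * volume E := by
        rw [← Finset.sum_mul, ← ENNReal.ofReal_sum_of_nonneg fun i _ => (Real.exp_pos _).le,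
          ENNReal.ofReal_add (mul_nonneg (Finset.sum_nonneg fun _ _ => (Real.exp_pos _).le)
            (by positivity)) (by positivity), ENNReal.ofReal_mul
            (Finset.sum_nonneg fun _ _ => (Real.exp_pos _).le), add_mul, mul_assoc]
    _ ≤ _ := by gcongr

lemma sumLaw_closedBall_le {d n : ℕ} (hd : 0 < d) (ν : Measure ℝ) [IsProbabilityMeasure ν]
    {p : ℝ} (hp : 0 < p) (hν : concFn1 ν 1 ≤ 1 - p) (a : Fin n → EuclideanSpace ℝ (Fin d))
    (ha : ∀ t : EuclideanSpace ℝ (Fin d), ‖t‖ ^ 2 ≤ ∑ k, ⟪t, a k⟫ ^ 2) {α D γ : ℝ}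
    (hα : 0 < α) (hD : 0 < D) (hγ : 0 < γ)
    (hlcd : ∀ (m : Fin n → ℤ) (t : EuclideanSpace ℝ (Fin d)), ‖t‖ ≤ D →
      min (γ * Real.sqrt (∑ k, ⟪t, a k⟫ ^ 2)) α ≤ Real.sqrt (∑ k, (⟪t, a k⟫ - m k) ^ 2))
    (x₀ : EuclideanSpace ℝ (Fin d)) :
    sumLaw ν a (Metric.closedBall x₀ (d / D)) ≤
      ENNReal.ofReal ((Real.exp (5 / 4) * Real.sqrt 2) ^ d *
        (4 * (Real.pi * Real.sqrt (2 * Real.pi) *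
          (Real.sqrt d / (γ * D * Real.sqrt p))) ^ d +
        Real.exp 1 * Real.exp (-2 * p * α ^ 2))) := by
  have hpi := Real.pi_pos
  have : IsProbabilityMeasure (sumLaw ν a) :=
    Measure.isProbabilityMeasure_map (Measurable.aemeasurable (by fun_prop))
  set κ : Measure ℝ := (symmetrization ν)[|{z | 1 < |z|}] with hκ
  have hmeasA : MeasurableSet {z : ℝ | 1 < |z|} := measurableSet_lt (by fun_prop) (by fun_prop)
  have hκprob : IsProbabilityMeasure κ := by
    refine cond_isProbabilityMeasure fun h0 => ?_
    have := le_symmetrization_real_of_concFn1_le ν hν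
    simp [Measure.real, h0] at this
    linarith
  have hκae : ∀ᵐ z ∂κ, 1 < |z| := ae_cond_mem hmeasA
  set b : ℝ := d / D ^ 2 with hb
  have hb0 : 0 < b := by positivity
  set M : ℝ := 4 * (Real.pi * Real.sqrt (2 * Real.pi) *
          (Real.sqrt d / (γ * D * Real.sqrt p))) ^ d +
        Real.exp 1 * Real.exp (-2 * p * α ^ 2) with hM
  have hM0 : 0 ≤ M := by positivity
  let F : ℝ → EuclideanSpace ℝ (Fin d) → ENNReal := fun z t => ENNReal.ofReal
    (Real.exp (-4 * p * sqDistInt fun k => z * ⟪t, a k⟫ / (2 * Real.pi)))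
  have hFcont : Continuous (Function.uncurry F) := by
    have h : Continuous fun q : ℝ × EuclideanSpace ℝ (Fin d) =>
        sqDistInt fun k => q.1 * ⟪q.2, a k⟫ / (2 * Real.pi) :=
      continuous_sqDistInt.comp (by fun_prop)
    exact ENNReal.continuous_ofReal.comp (Real.continuous_exp.comp (continuous_const.mul h))
  have hFz (z : ℝ) : Measurable (F z) := (hFcont.comp (Continuous.prodMk_right z)).measurable
  have hchar (t : EuclideanSpace ℝ (Fin d)) :
      ENNReal.ofReal ‖charFun (sumLaw ν a) t‖ ≤ ∫⁻ z, F z t ∂κ := by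
    refine (ENNReal.ofReal_le_ofReal (norm_charFun_sumLaw_le ν hp hν a t)).trans ?_
    rw [ofReal_integral_eq_lintegral_ofReal _ (.of_forall fun _ => (Real.exp_pos _).le)]
    have h : Continuous fun z : ℝ => sqDistInt fun k => z * ⟪t, a k⟫ / (2 * Real.pi) :=
      continuous_sqDistInt.comp (by fun_prop)
    refine Integrable.of_bound (C := 1)
      (Real.continuous_exp.comp (continuous_const.mul h)).aestronglyMeasurable
      (.of_forall fun z => ?_)
    rw [Real.norm_of_nonneg (Real.exp_pos _).le, Real.exp_le_one_iff]
    nlinarith [mul_nonneg hp.le (sqDistInt_nonneg fun k => z * ⟪t, a k⟫ / (2 * Real.pi))]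
  set B : ℝ := Real.exp d * Real.sqrt (2 * Real.pi / b) ^ d with hB
  have hlocal (z : ℝ) (hz : 1 < |z|) :
      ∫⁻ t, ENNReal.ofReal (Real.exp (-b * ‖t‖ ^ 2)) * F z t ≤ ENNReal.ofReal (B * M) := by
    have hz0 : 0 < |z| := by linarith
    have hρ : D / |z| ≤ D := div_le_self hD.le hz.le
    refine (lintegral_gaussian_mul_le_of_local_average hb0 (ρ := D / |z|) (by positivity) (hFz z)
      (lintegral_exp_neg_sqDistInt_le hd hp a ha hα hD hγ hlcd hz0)).trans ?_
    rw [← ENNReal.ofReal_mul (by positivity), finrank_euclideanSpace_fin]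
    have hbρ : b * (D / |z|) ^ 2 ≤ (d : ℝ) := by
      calc b * (D / |z|) ^ 2 ≤ b * D ^ 2 := by gcongr
        _ = (d : ℝ) := by rw [hb]; field_simp
    rw [hB]
    gcongr
  have hFswap : AEMeasurable (Function.uncurry fun (t : EuclideanSpace ℝ (Fin d)) (z : ℝ) =>
      ENNReal.ofReal (Real.exp (-b * ‖t‖ ^ 2)) * F z t) (volume.prod κ) := by
    refine Measurable.aemeasurable ?_
    refine Measurable.mul (f := fun q : EuclideanSpace ℝ (Fin d) × ℝ =>
      ENNReal.ofReal (Real.exp (-b * ‖q.1‖ ^ 2))) (by fun_prop)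
      (hFcont.comp continuous_swap).measurable
  have hint : ∫⁻ t, ENNReal.ofReal (Real.exp (-b * ‖t‖ ^ 2)) *
      ENNReal.ofReal ‖charFun (sumLaw ν a) t‖ ≤ ENNReal.ofReal (B * M) := by
    calc _ ≤ ∫⁻ t, ENNReal.ofReal (Real.exp (-b * ‖t‖ ^ 2)) * ∫⁻ z, F z t ∂κ := by
          gcongr with t
          exact hchar t
      _ = ∫⁻ t, ∫⁻ z, ENNReal.ofReal (Real.exp (-b * ‖t‖ ^ 2)) * F z t ∂κ := by
          refine lintegral_congr fun t => ?_
          rw [lintegral_const_mul' _ _ ENNReal.ofReal_ne_top]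
      _ = ∫⁻ z, (∫⁻ t, ENNReal.ofReal (Real.exp (-b * ‖t‖ ^ 2)) * F z t) ∂κ :=
          lintegral_lintegral_swap hFswap
      _ ≤ ∫⁻ _, ENNReal.ofReal (B * M) ∂κ := lintegral_mono_ae (hκae.mono hlocal)
      _ = _ := by simp
  refine (measure_closedBall_le_lintegral_charFun (sumLaw ν a) hb0 x₀).trans ?_
  refine (mul_le_mul_right hint _).trans ?_
  rw [← ENNReal.ofReal_mul (by positivity), finrank_euclideanSpace_fin]
  apply le_of_eq
  congr 1
  have hexp : Real.exp ((d / D) ^ 2 / (4 * b)) = Real.exp (1 / 4) ^ d := by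
    rw [← Real.exp_nat_mul, hb]
    congr 1
    field_simp
  have hexpd : Real.exp (d : ℝ) = Real.exp 1 ^ d := by rw [← Real.exp_nat_mul, mul_one]
  have hsqrt : Real.sqrt (b / Real.pi) * Real.sqrt (2 * Real.pi / b) = Real.sqrt 2 := by
    rw [← Real.sqrt_mul (by positivity)]
    congr 1
    field_simp
  have hexp54 : Real.exp (5 / 4) = Real.exp (1 / 4) * Real.exp 1 := by
    rw [← Real.exp_add]
    norm_num
  rw [hB, hexp, hexpd, ← hsqrt, hexp54]
  simp only [mul_pow]
  ring

lemma concFn_sumLaw_le_one {d n : ℕ} (ν : Measure ℝ) [IsProbabilityMeasure ν]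
    (a : Fin n → EuclideanSpace ℝ (Fin d)) (r : ℝ) : concFn (sumLaw ν a) r ≤ 1 := by
  have : IsProbabilityMeasure (sumLaw ν a) :=
    Measure.isProbabilityMeasure_map (Measurable.aemeasurable (by fun_prop))
  exact ciSup_le fun _ => measureReal_le_one

end ConcentrationBound

theorem stmt_10 :
    ∃ c₁ : ℝ, 0 < c₁ ∧
      ∀ (d n : ℕ),
      ∀ (ν : Measure ℝ), IsProbabilityMeasure ν →
      ∀ p : ℝ, 0 < p → concFn1 ν 1 ≤ 1 - p →
      ∀ (a : Fin n → EuclideanSpace ℝ (Fin d)),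
      (∀ t : EuclideanSpace ℝ (Fin d), ‖t‖ ^ 2 ≤ ∑ k, ⟪t, a k⟫ ^ 2) →
      ∀ α D γ : ℝ, 0 < α → 0 < D → 0 < γ → γ < 1 →
      (∀ (m : Fin n → ℤ) (t : EuclideanSpace ℝ (Fin d)),
        ‖t‖ ≤ D →
        min (γ * Real.sqrt (∑ k, ⟪t, a k⟫ ^ 2)) α ≤
          Real.sqrt (∑ k, (⟪t, a k⟫ - m k) ^ 2)) →
      concFn (sumLaw ν a) (d / D) ≤
        c₁ ^ d * ((Real.sqrt d / (γ * D * Real.sqrt p)) ^ d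
          + Real.exp (-2 * p * α ^ 2)) := by
  have hpi := Real.pi_pos
  set A : ℝ := Real.pi * Real.sqrt (2 * Real.pi) with hA
  have hA1 : 1 ≤ A := by
    have h2 := Real.two_le_pi
    have : 1 ≤ Real.sqrt (2 * Real.pi) := Real.one_le_sqrt.2 (by linarith)
    nlinarith
  refine ⟨Real.exp (5 / 4) * Real.sqrt 2 * (4 * A), by positivity, ?_⟩
  intro d n ν hprob p hp hν a ha α D γ hα hD hγ _ hlcd
  rcases Nat.eq_zero_or_pos d with rfl | hd
  · refine (concFn_sumLaw_le_one ν a _).trans ?_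
    simp only [pow_zero, one_mul]
    linarith [Real.exp_pos (-2 * p * α ^ 2)]
  set X : ℝ := (Real.sqrt d / (γ * D * Real.sqrt p)) ^ d with hX
  have hX0 : 0 ≤ X := by positivity
  have hbound : 4 * (A * (Real.sqrt d / (γ * D * Real.sqrt p))) ^ d +
      Real.exp 1 * Real.exp (-2 * p * α ^ 2) ≤
      (4 * A) ^ d * (X + Real.exp (-2 * p * α ^ 2)) := by
    have h4 : (4 : ℝ) ≤ 4 ^ d := le_self_pow₀ (by norm_num) hd.ne'
    have hAd : 1 ≤ A ^ d := one_le_pow₀ hA1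
    have he : Real.exp 1 ≤ 4 := by linarith [Real.exp_one_lt_d9]
    rw [mul_pow A, mul_pow 4 A, mul_add, ← hX]
    have h1 : 4 * (A ^ d * X) ≤ 4 ^ d * (A ^ d * X) := by gcongr
    have h2 : Real.exp 1 ≤ 4 ^ d * A ^ d := by nlinarith
    have h3 : Real.exp 1 * Real.exp (-2 * p * α ^ 2) ≤
        4 ^ d * A ^ d * Real.exp (-2 * p * α ^ 2) := by gcongr
    linarith
  refine ciSup_le fun x₀ => ?_
  refine (ENNReal.toReal_le_of_le_ofReal (by positivity)
    (sumLaw_closedBall_le hd ν hp hν a ha hα hD hγ hlcd x₀)).trans ?_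
  rw [mul_pow (Real.exp (5 / 4) * Real.sqrt 2), mul_assoc (_ ^ d)]
  gcongr
end

section
/- There exists an absolute constant c > 0 such that for every dimension d ≥ 1 and every symmetric probability distribution F on ℝ^d (i.e., the laws of Y and −Y coincide) whose characteristic function satisfies F̂(t) ≥ 0 for all t ∈ ℝ^d, one has ∫_{‖t‖ ≤ √d} F̂(t) dt ≤ c^d Q(F, √d). -/
open MeasureTheory
open scoped RealInnerProductSpace

/-- The characteristic function `F̂(t) = E exp(i⟨t, Y⟩)` of a measure on `ℝ^d`. -/
noncomputable def charF {d : ℕ} (μ : Measure (EuclideanSpace ℝ (Fin d)))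
    (t : EuclideanSpace ℝ (Fin d)) : ℂ :=
  ∫ x, Complex.exp ((⟪t, x⟫ : ℂ) * Complex.I) ∂μ

/-- The Euclidean ball of radius `√d` contains the cube `[-1, 1]^d`. -/
lemma two_pow_le_volume_closedBall_sqrt {d : ℕ} (y : EuclideanSpace ℝ (Fin d)) :
    ENNReal.ofReal (2 ^ d) ≤ volume (Metric.closedBall y (Real.sqrt d)) := by
  have hvol := (EuclideanSpace.volume_preserving_symm_measurableEquiv_toLp (Fin d)).symm
  rw [← hvol.measure_preimage Metric.isClosed_closedBall.measurableSet.nullMeasurableSet]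
  have hcube : ENNReal.ofReal (2 ^ d) =
      volume (Set.Icc (fun i => y i - 1) (fun i => y i + 1)) := by
    rw [Real.volume_Icc_pi]
    have h2 : ∀ a : ℝ, a + 1 - (a - 1) = 2 := fun a => by ring
    simp [h2, ENNReal.ofReal_pow]
  rw [hcube]
  refine measure_mono fun x hx => ?_
  rw [Set.mem_preimage, Metric.mem_closedBall, EuclideanSpace.dist_eq]
  refine Real.sqrt_le_sqrt ?_
  calc _ ≤ ∑ _i : Fin d, (1 : ℝ) := Finset.sum_le_sum fun i _ => by
        have h1 := hx.1 i
        have h2 := hx.2 i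
        simp only [Real.dist_eq, sq_abs] at h1 h2 ⊢
        change (x i - y i) ^ 2 ≤ 1
        nlinarith
    _ = d := by simp

lemma measure_closedBall_le_concFn {d : ℕ} (μ : Measure (EuclideanSpace ℝ (Fin d)))
    [IsProbabilityMeasure μ] (r : ℝ) (x : EuclideanSpace ℝ (Fin d)) :
    μ (Metric.closedBall x r) ≤ ENNReal.ofReal (concFn μ r) := by
  rw [← ENNReal.ofReal_toReal (measure_ne_top μ _)]
  refine ENNReal.ofReal_le_ofReal (le_ciSup (f := fun x => (μ (Metric.closedBall x r)).toReal)
    ⟨1, ?_⟩ x)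
  rintro _ ⟨z, rfl⟩
  exact measureReal_le_one

lemma concFn_nonneg {d : ℕ} (μ : Measure (EuclideanSpace ℝ (Fin d))) (r : ℝ) :
    0 ≤ concFn μ r :=
  Real.iSup_nonneg fun _ => ENNReal.toReal_nonneg

lemma integrable_exp_neg_mul_sq_norm {d : ℕ} {b : ℝ} (hb : 0 < b) :
    Integrable fun x : EuclideanSpace ℝ (Fin d) => Real.exp (-b * ‖x‖ ^ 2) := by
  have h := (GaussianFourier.integrable_cexp_neg_mul_sq_norm_add (b := (b : ℂ))
    (by simpa using hb) 0 (0 : EuclideanSpace ℝ (Fin d))).re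
  refine h.congr (Filter.Eventually.of_forall fun x => ?_)
  have : (-(b : ℂ) * (‖x‖ : ℂ) ^ 2) = ((-b * ‖x‖ ^ 2 : ℝ) : ℂ) := by push_cast; ring
  simp only [zero_mul, add_zero, this]
  exact Complex.exp_ofReal_re _

/-- A Gaussian is dominated by an average of indicators of balls of radius `√d`. -/
lemma exp_mul_exp_le_lintegral_indicator {d : ℕ} (y : EuclideanSpace ℝ (Fin d)) :
    ENNReal.ofReal (2 ^ d * Real.exp (-(d / 2 : ℝ))) *
        ENNReal.ofReal (Real.exp (-(1 / 2) * ‖y‖ ^ 2)) ≤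
      ∫⁻ x, (Metric.closedBall x (Real.sqrt d)).indicator
        (fun _ => ENNReal.ofReal (Real.exp (-(1 / 4) * ‖x‖ ^ 2))) y := by
  have hsq : Real.sqrt d ^ 2 = d := Real.sq_sqrt (Nat.cast_nonneg d)
  calc _ = ENNReal.ofReal (Real.exp (-(d / 2 : ℝ) + -(1 / 2) * ‖y‖ ^ 2)) *
          ENNReal.ofReal (2 ^ d) := by
        rw [← ENNReal.ofReal_mul (by positivity), ← ENNReal.ofReal_mul (by positivity),
          Real.exp_add]
        congr 1
        ring
    _ ≤ ENNReal.ofReal (Real.exp (-(d / 2 : ℝ) + -(1 / 2) * ‖y‖ ^ 2)) *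
          volume (Metric.closedBall y (Real.sqrt d)) := by
        gcongr
        exact two_pow_le_volume_closedBall_sqrt y
    _ = ∫⁻ x, (Metric.closedBall y (Real.sqrt d)).indicator
          (fun _ => ENNReal.ofReal (Real.exp (-(d / 2 : ℝ) + -(1 / 2) * ‖y‖ ^ 2))) x := by
        rw [lintegral_indicator_const Metric.isClosed_closedBall.measurableSet]
    _ ≤ _ := by
        refine lintegral_mono fun x => ?_
        by_cases hx : x ∈ Metric.closedBall y (Real.sqrt d)
        · rw [Set.indicator_of_mem hx, Set.indicator_of_mem (Metric.mem_closedBall_comm.1 hx)]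
          refine ENNReal.ofReal_le_ofReal (Real.exp_le_exp.2 ?_)
          rw [mem_closedBall_iff_norm] at hx
          have h1 : ‖x‖ ≤ ‖y‖ + ‖x - y‖ := by simpa using norm_add_le y (x - y)
          nlinarith [norm_nonneg x, norm_nonneg y, norm_nonneg (x - y), Real.sqrt_nonneg d,
            sq_nonneg (‖y‖ - ‖x - y‖), pow_le_pow_left₀ (norm_nonneg x) h1 2,
            pow_le_pow_left₀ (norm_nonneg (x - y)) hx 2]
        · rw [Set.indicator_of_notMem hx]
          exact zero_le

lemma integral_exp_neg_sq_norm_le_concFn {d : ℕ} (μ : Measure (EuclideanSpace ℝ (Fin d)))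
    [IsProbabilityMeasure μ] :
    2 ^ d * Real.exp (-(d / 2 : ℝ)) * ∫ y, Real.exp (-(1 / 2) * ‖y‖ ^ 2) ∂μ ≤
      (4 * Real.pi) ^ (d / 2 : ℝ) * concFn μ (Real.sqrt d) := by
  have hint : Integrable (fun y : EuclideanSpace ℝ (Fin d) =>
      Real.exp (-(1 / 2) * ‖y‖ ^ 2)) μ := by
    refine (integrable_const (1 : ℝ)).mono' (by fun_prop) (Filter.Eventually.of_forall fun y => ?_)
    rw [Real.norm_eq_abs, Real.abs_exp, Real.exp_le_one_iff]
    nlinarith [sq_nonneg ‖y‖]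
  have hgauss : ∫⁻ x : EuclideanSpace ℝ (Fin d),
      ENNReal.ofReal (Real.exp (-(1 / 4) * ‖x‖ ^ 2)) =
        ENNReal.ofReal ((4 * Real.pi) ^ (d / 2 : ℝ)) := by
    rw [← ofReal_integral_eq_lintegral_ofReal (integrable_exp_neg_mul_sq_norm (by norm_num))
      (Filter.Eventually.of_forall fun x => (Real.exp_pos _).le),
      GaussianFourier.integral_rexp_neg_mul_sq_norm (by norm_num), finrank_euclideanSpace_fin]
    congr 2
    ring
  rw [← ENNReal.ofReal_le_ofReal_iff (by have := concFn_nonneg μ (Real.sqrt d); positivity),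
    ENNReal.ofReal_mul (p := 2 ^ d * Real.exp (-(d / 2 : ℝ))) (by positivity),
    ofReal_integral_eq_lintegral_ofReal hint
      (Filter.Eventually.of_forall fun x => (Real.exp_pos _).le),
    ENNReal.ofReal_mul (p := (4 * Real.pi) ^ (d / 2 : ℝ)) (by positivity), ← hgauss,
    ← lintegral_const_mul _ (by fun_prop), ← lintegral_mul_const _ (by fun_prop)]
  refine (lintegral_mono exp_mul_exp_le_lintegral_indicator).trans ?_
  rw [lintegral_lintegral_swap]
  · refine lintegral_mono fun x => ?_
    rw [lintegral_indicator_const Metric.isClosed_closedBall.measurableSet]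
    gcongr
    exact measure_closedBall_le_concFn μ _ x
  · have hm : MeasurableSet {p : EuclideanSpace ℝ (Fin d) × EuclideanSpace ℝ (Fin d) |
        dist p.1 p.2 ≤ Real.sqrt d} := measurableSet_le (by fun_prop) (by fun_prop)
    have hf : Measurable fun p : EuclideanSpace ℝ (Fin d) × EuclideanSpace ℝ (Fin d) =>
        ENNReal.ofReal (Real.exp (-(1 / 4) * ‖p.2‖ ^ 2)) := by fun_prop
    exact (hf.indicator hm).aemeasurable

/-- Integrating a characteristic function against a Gaussian. -/
lemma integral_charF_mul_exp {d : ℕ} (μ : Measure (EuclideanSpace ℝ (Fin d)))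
    [IsProbabilityMeasure μ] :
    ∫ t, charF μ t * (Real.exp (-(1 / 2) * ‖t‖ ^ 2) : ℂ) =
      (((2 * Real.pi) ^ (d / 2 : ℝ) * ∫ y, Real.exp (-(1 / 2) * ‖y‖ ^ 2) ∂μ : ℝ) : ℂ) := by
  have hfourier : ∀ y : EuclideanSpace ℝ (Fin d),
      ∫ t : EuclideanSpace ℝ (Fin d), Complex.exp ((⟪t, y⟫ : ℂ) * Complex.I) *
        (Real.exp (-(1 / 2) * ‖t‖ ^ 2) : ℂ) =
      (((2 * Real.pi) ^ (d / 2 : ℝ) * Real.exp (-(1 / 2) * ‖y‖ ^ 2) : ℝ) : ℂ) := by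
    intro y
    have h := GaussianFourier.integral_cexp_neg_mul_sq_norm_add (b := (1 / 2 : ℂ))
      (by norm_num) Complex.I y
    rw [finrank_euclideanSpace_fin] at h
    calc _ = ∫ t : EuclideanSpace ℝ (Fin d),
          Complex.exp (-(1 / 2) * (‖t‖ : ℂ) ^ 2 + Complex.I * (⟪y, t⟫ : ℂ)) := by
          refine integral_congr_ae (Filter.Eventually.of_forall fun t => ?_)
          simp only
          rw [Complex.ofReal_exp, ← Complex.exp_add, real_inner_comm]
          congr 1
          push_cast
          ring
      _ = _ := by
          rw [h, Complex.ofReal_mul, Complex.ofReal_exp, Complex.ofReal_cpow (by positivity)]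
          push_cast
          rw [Complex.I_sq]
          congr 2 <;> ring
  simp only [charF, ← integral_mul_const]
  rw [integral_integral_swap]
  · simp only [hfourier]
    rw [integral_complex_ofReal, integral_const_mul]
  · have hg := (integrable_exp_neg_mul_sq_norm (d := d) (b := 1 / 2) (by norm_num)).comp_fst μ
    refine hg.mono' (by
      refine Continuous.aestronglyMeasurable ?_
      simp only [Function.uncurry_def]
      fun_prop) (Filter.Eventually.of_forall fun p => ?_)
    simp only [Function.uncurry]
    rw [norm_mul, Complex.norm_exp_ofReal_mul_I, one_mul, Complex.norm_real, Real.norm_eq_abs,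
      Real.abs_exp]

lemma norm_charF_le_one {d : ℕ} (μ : Measure (EuclideanSpace ℝ (Fin d)))
    [IsProbabilityMeasure μ] (t : EuclideanSpace ℝ (Fin d)) : ‖charF μ t‖ ≤ 1 := by
  refine (norm_integral_le_integral_norm _).trans ?_
  simp [Complex.norm_exp_ofReal_mul_I]

lemma stronglyMeasurable_charF {d : ℕ} (μ : Measure (EuclideanSpace ℝ (Fin d)))
    [IsProbabilityMeasure μ] : StronglyMeasurable (charF μ) := by
  refine StronglyMeasurable.integral_prod_right (f := fun t x : EuclideanSpace ℝ (Fin d) =>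
    Complex.exp ((⟪t, x⟫ : ℂ) * Complex.I)) ?_
  refine Continuous.stronglyMeasurable ?_
  simp only [Function.uncurry_def]
  fun_prop

theorem stmt_12 :
    ∃ c : ℝ, 0 < c ∧
      ∀ (d : ℕ), 1 ≤ d →
      ∀ (μ : Measure (EuclideanSpace ℝ (Fin d))), IsProbabilityMeasure μ →
      -- `F` is symmetric: the laws of `Y` and `-Y` coincide
      μ.map (fun x => -x) = μ →
      -- the characteristic function is nonnegative (it is a real number, and `≥ 0`)
      (∀ t, charF μ t = ((charF μ t).re : ℂ) ∧ 0 ≤ (charF μ t).re) →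
      (∫ t in Metric.closedBall (0 : EuclideanSpace ℝ (Fin d)) (Real.sqrt d),
          (charF μ t).re) ≤
        c ^ d * concFn μ (Real.sqrt d) := by
  refine ⟨Real.exp 1 * Real.sqrt (2 * Real.pi) * Real.sqrt (4 * Real.pi) / 2, by positivity, ?_⟩
  intro d _ μ _ _ hpos
  have hgint : Integrable fun t : EuclideanSpace ℝ (Fin d) =>
      (charF μ t).re * Real.exp (-(1 / 2) * ‖t‖ ^ 2) := by
    refine (integrable_exp_neg_mul_sq_norm (b := 1 / 2) (by norm_num)).bdd_mul (c := 1)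
      (Complex.continuous_re.comp_stronglyMeasurable
        (stronglyMeasurable_charF μ)).aestronglyMeasurable
      (Filter.Eventually.of_forall fun t => ?_)
    exact (Complex.abs_re_le_norm _).trans (norm_charF_le_one μ t)
  have hgauss : ∫ t, (charF μ t).re * Real.exp (-(1 / 2) * ‖t‖ ^ 2) =
      (2 * Real.pi) ^ (d / 2 : ℝ) * ∫ y, Real.exp (-(1 / 2) * ‖y‖ ^ 2) ∂μ := by
    apply Complex.ofReal_injective
    rw [← integral_charF_mul_exp, ← integral_complex_ofReal]
    refine integral_congr_ae (Filter.Eventually.of_forall fun t => ?_)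
    simp only
    rw [Complex.ofReal_mul, ← (hpos t).1]
  have hball : ∫ t in Metric.closedBall (0 : EuclideanSpace ℝ (Fin d)) (Real.sqrt d),
      (charF μ t).re ≤ Real.exp (d / 2 : ℝ) *
        ∫ t, (charF μ t).re * Real.exp (-(1 / 2) * ‖t‖ ^ 2) := by
    rw [← integral_const_mul]
    refine le_trans ?_ (setIntegral_le_integral (s := Metric.closedBall 0 (Real.sqrt d))
      (hgint.const_mul _)
      (Filter.Eventually.of_forall fun t => mul_nonneg (Real.exp_pos _).le
        (mul_nonneg (hpos t).2 (Real.exp_pos _).le)))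
    refine integral_mono_of_nonneg (Filter.Eventually.of_forall fun t => (hpos t).2)
      (hgint.const_mul _).integrableOn ?_
    filter_upwards [ae_restrict_mem Metric.isClosed_closedBall.measurableSet] with t ht
    rw [mem_closedBall_zero_iff] at ht
    have hsq : ‖t‖ ^ 2 ≤ d := by
      simpa [Real.sq_sqrt (Nat.cast_nonneg d)] using pow_le_pow_left₀ (norm_nonneg t) ht 2
    have h1 : 1 ≤ Real.exp (d / 2 : ℝ) * Real.exp (-(1 / 2) * ‖t‖ ^ 2) := by
      rw [← Real.exp_add, Real.one_le_exp_iff]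
      linarith
    nlinarith [(hpos t).2]
  have hconc := integral_exp_neg_sq_norm_le_concFn μ
  have hpow : ∀ a : ℝ, 0 ≤ a → a ^ (d / 2 : ℝ) = Real.sqrt a ^ d := fun a ha => by
    rw [Real.sqrt_eq_rpow, ← Real.rpow_mul_natCast ha]
    congr 1
    ring
  rw [hpow _ (by positivity)] at hgauss hconc
  rw [hgauss] at hball
  have hexp : Real.exp 1 ^ d = Real.exp (d / 2 : ℝ) * Real.exp (d / 2 : ℝ) := by
    rw [← Real.exp_nat_mul, ← Real.exp_add]
    congr 1
    ring
  have hcancel : Real.exp (d / 2 : ℝ) * Real.exp (-(d / 2 : ℝ)) = 1 := by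
    rw [← Real.exp_add, add_neg_cancel, Real.exp_zero]
  refine hball.trans ?_
  rw [div_pow, mul_pow, mul_pow, hexp, div_mul_eq_mul_div, le_div_iff₀ (by positivity)]
  calc _ = Real.exp (d / 2 : ℝ) * Real.exp (d / 2 : ℝ) * Real.sqrt (2 * Real.pi) ^ d *
        (2 ^ d * Real.exp (-(d / 2 : ℝ)) * ∫ y, Real.exp (-(1 / 2) * ‖y‖ ^ 2) ∂μ) := by
        linear_combination (-(Real.exp (d / 2 : ℝ) * Real.sqrt (2 * Real.pi) ^ d * 2 ^ d *
          ∫ y, Real.exp (-(1 / 2) * ‖y‖ ^ 2) ∂μ)) * hcancel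
    _ ≤ Real.exp (d / 2 : ℝ) * Real.exp (d / 2 : ℝ) * Real.sqrt (2 * Real.pi) ^ d *
        (Real.sqrt (4 * Real.pi) ^ d * concFn μ (Real.sqrt d)) := by gcongr
    _ = _ := by ring
end
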